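/- arXiv:1305.3960 — 6 statements merged into one kernel-verified Lean document; each statement's English description precedes it below -/
import Mathlib

section
/- Let P₁, …, P_{d+1} be non-empty finite point sets in ℝ^d. If x ∈ conv(P_i ∪ P_j) for all 1 ≤ i < j ≤ d+1, then there exist p₁ ∈ P₁, …, p_{d+1} ∈ P_{d+1} such that x ∈ conv{p₁, …, p_{d+1}}. -/
theorem exists_nonneg_add_smul_eq_zero {κ : Type*} [Fintype κ] {c n : κ → ℝ}
    (hc : 0 ≤ c) (hn : ∃ k, n k < 0) :
    ∃ t : ℝ, 0 ≤ t ∧ 0 ≤ c + t • n ∧ ∃ k, n k < 0 ∧ (c + t • n) k = 0 := by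
  classical
  obtain ⟨k, hk, hmin⟩ := Finset.exists_min_image (Finset.univ.filter fun k => n k < 0)
    (fun k => c k / -n k) (by simpa [Finset.Nonempty] using hn)
  simp only [Finset.mem_filter, Finset.mem_univ, true_and] at hk hmin
  have ht : 0 ≤ c k / -n k := div_nonneg (hc k) (by linarith)
  refine ⟨c k / -n k, ht, fun i => ?_, k, hk, ?_⟩
  · change 0 ≤ c i + c k / -n k * n i
    rcases lt_or_ge (n i) 0 with hi | hi
    · have := hmin i hi
      rw [le_div_iff₀ (by linarith)] at this
      linarith
    · have := mul_nonneg ht hi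
      have := hc i
      simp only [Pi.zero_apply] at this
      linarith
  · change c k + c k / -n k * n k = 0
    rw [div_neg, neg_mul, div_mul_cancel₀ _ hk.ne, add_neg_cancel]

section Orthant

variable {κ E : Type*} [Fintype κ] [AddCommGroup E] [Module ℝ E] {L : (κ → ℝ) →ₗ[ℝ] E} {v : E}

/-- The fiber of `L` over `v` meets the facet `c k = 0` of the nonnegative orthant. -/
def MeetsFacet (L : (κ → ℝ) →ₗ[ℝ] E) (v : E) (k : κ) : Prop :=
  ∃ c : κ → ℝ, 0 ≤ c ∧ c k = 0 ∧ L c = v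

/-- Every vector in the fiber of `L` over `v` has at most one vanishing coordinate. -/
def IsGenericValue (L : (κ → ℝ) →ₗ[ℝ] E) (v : E) : Prop :=
  ∀ c k k', L c = v → c k = 0 → c k' = 0 → k = k'

theorem IsGenericValue.eq_zero_of_mem_ker (hv : IsGenericValue L v) {c n : κ → ℝ} {k : κ}
    (hc : 0 ≤ c) (hck : c k = 0) (hLc : L c = v) (hn : L n = 0) (hnk : n k = 0) : n = 0 := by
  have nonneg : ∀ m : κ → ℝ, L m = 0 → m k = 0 → 0 ≤ m := by
    intro m hm hmk
    by_contra hneg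
    obtain ⟨t, -, -, i, hi, hi0⟩ := exists_nonneg_add_smul_eq_zero hc
      (by simpa [Pi.le_def] using hneg)
    obtain rfl := hv (c + t • m) k i (by simp [hLc, hm]) (by simp [hck, hmk]) hi0
    exact hi.ne hmk
  refine le_antisymm ?_ (nonneg n hn hnk)
  simpa using nonneg (-n) (by simpa using hn) (by simpa using hnk)

theorem IsGenericValue.eq_add_smul (hv : IsGenericValue L v) {c n c' : κ → ℝ} {k : κ}
    (hc : 0 ≤ c) (hck : c k = 0) (hLc : L c = v) (hn : L n = 0) (hnk : 0 < n k)
    (hc' : 0 ≤ c') (hLc' : L c' = v) : ∃ s : ℝ, 0 ≤ s ∧ c' = c + s • n := by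
  refine ⟨c' k / n k, div_nonneg (hc' k) hnk.le, ?_⟩
  have := hv.eq_zero_of_mem_ker (n := c' - c - (c' k / n k) • n) hc hck hLc
    (by simp [hn, hLc, hLc']) (by simp [hck, hnk.ne'])
  rw [sub_sub, sub_eq_zero] at this
  exact this

theorem IsGenericValue.even_card_meetsFacet [DecidablePred (MeetsFacet L v)]
    (hv : IsGenericValue L v) (hker : ∃ n, n ≠ 0 ∧ L n = 0)
    (hray : ∀ n : κ → ℝ, 0 ≤ n → L n = 0 → n = 0) :
    Even (Finset.univ.filter (MeetsFacet L v)).card := by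
  classical
  rcases (Finset.univ.filter (MeetsFacet L v)).eq_empty_or_nonempty with h | ⟨k, hk⟩
  · simp [h]
  obtain ⟨c, hc, hck, hLc⟩ := (Finset.mem_filter.1 hk).2
  obtain ⟨n, hLn, hnk⟩ : ∃ n, L n = 0 ∧ 0 < n k := by
    obtain ⟨n, hn0, hLn⟩ := hker
    have : n k ≠ 0 := fun h => hn0 (hv.eq_zero_of_mem_ker hc hck hLc hLn h)
    rcases this.lt_or_gt with h | h
    · exact ⟨-n, by simpa using hLn, by simpa using h⟩
    · exact ⟨n, hLn, h⟩
  have hneg : ∃ i, n i < 0 := by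
    by_contra! h
    simp [hray n h hLn] at hnk
  obtain ⟨t, ht, hct, i, hi, hi0⟩ := exists_nonneg_add_smul_eq_zero hc hneg
  have hki : k ≠ i := by rintro rfl; exact hi.not_gt hnk
  have : Finset.univ.filter (MeetsFacet L v) = {k, i} := by
    ext m
    simp only [Finset.mem_filter, Finset.mem_univ, true_and, Finset.mem_insert,
      Finset.mem_singleton]
    constructor
    · rintro ⟨c', hc', hcm, hLc'⟩
      obtain ⟨s, hs, rfl⟩ := hv.eq_add_smul hc hck hLc hLn hnk hc' hLc'
      rcases hs.eq_or_lt with rfl | hs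
      · exact Or.inl (hv _ _ _ hLc' hcm (by simp [hck]))
      rcases lt_trichotomy s t with hst | rfl | hst
      · left
        refine hv c m k hLc ?_ hck
        have h1 := hct m
        have h2 := hc m
        simp only [Pi.zero_apply, Pi.add_apply, Pi.smul_apply, smul_eq_mul] at h1 h2 hcm
        nlinarith
      · exact Or.inr (hv _ _ _ hLc' hcm hi0)
      · have h1 := hc' i
        simp only [Pi.zero_apply, Pi.add_apply, Pi.smul_apply, smul_eq_mul] at h1 hi0
        nlinarith
    · rintro (rfl | rfl)
      · exact ⟨c, hc, hck, hLc⟩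
      · exact ⟨_, hct, hi0, by simp [hLc, hLn]⟩
  rw [this, Finset.card_pair hki]
  exact even_two

theorem IsGenericValue.card_meetsFacet_eq_one [DecidablePred (MeetsFacet L v)]
    (hv : IsGenericValue L v) (hray : ∃ n, 0 ≤ n ∧ n ≠ 0 ∧ L n = 0)
    (hne : ∃ c, 0 ≤ c ∧ L c = v) :
    (Finset.univ.filter (MeetsFacet L v)).card = 1 := by
  obtain ⟨n, hn, hn0, hLn⟩ := hray
  obtain ⟨c₀, hc₀, hLc₀⟩ := hne
  obtain ⟨t, -, hc, k, hnk, hck⟩ := exists_nonneg_add_smul_eq_zero (n := -n) hc₀ (by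
    by_contra! h
    exact hn0 (le_antisymm (fun i => by simpa using h i) hn))
  replace hnk : 0 < n k := by simpa using hnk
  have hLc : L (c₀ + t • -n) = v := by simp [hLc₀, hLn]
  refine Finset.card_eq_one.2 ⟨k, ?_⟩
  ext m
  simp only [Finset.mem_filter, Finset.mem_univ, true_and, Finset.mem_singleton]
  refine ⟨?_, ?_⟩
  · rintro ⟨c', hc', hcm, hLc'⟩
    obtain ⟨s, hs, rfl⟩ := hv.eq_add_smul hc hck hLc hLn hnk hc' hLc'
    refine hv _ _ _ hLc ?_ hck
    have h1 := hc m
    have h2 := mul_nonneg hs (hn m)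
    simp only [Pi.zero_apply, Pi.add_apply, Pi.smul_apply, Pi.neg_apply, smul_eq_mul]
      at h1 h2 hcm ⊢
    linarith
  · rintro rfl
    exact ⟨_, hc, hck, hLc⟩

end Orthant

theorem mem_convexHull_range_iff {ι E : Type*} [Fintype ι] [AddCommGroup E] [Module ℝ E]
    {p : ι → E} {v : E} :
    v ∈ convexHull ℝ (Set.range p) ↔
      ∃ w : ι → ℝ, 0 ≤ w ∧ ∑ i, w i = 1 ∧ ∑ i, w i • p i = v := by
  classical
  constructor
  · intro hv
    have hconv := (convex_stdSimplex ℝ ι).linear_image (Fintype.linearCombination ℝ p)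
    obtain ⟨w, hw, rfl⟩ := convexHull_min (by
      rintro _ ⟨i, rfl⟩
      exact ⟨_, single_mem_stdSimplex ℝ i, by simp⟩) hconv hv
    exact ⟨w, hw.1, hw.2, rfl⟩
  · rintro ⟨w, hw, hw1, hv⟩
    exact mem_convexHull_of_exists_fintype w p hw hw1 (fun i => ⟨i, rfl⟩) hv

theorem dense_isGenericValue {κ E σ : Type*} [Fintype κ] [Finite σ] [NormedAddCommGroup E]
    [NormedSpace ℝ E] [FiniteDimensional ℝ E] (hcard : Fintype.card κ ≤ Module.finrank ℝ E + 1)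
    (L : σ → (κ → ℝ) →ₗ[ℝ] E) : Dense {v | ∀ s, IsGenericValue (L s) v} := by
  let _ : MeasurableSpace E := borel E
  have : BorelSpace E := ⟨rfl⟩
  refine MeasureTheory.Measure.dense_of_ae (μ := MeasureTheory.Measure.addHaar) ?_
  let S : κ → κ → Submodule ℝ (κ → ℝ) := fun k k' =>
    LinearMap.ker ((LinearMap.proj k : (κ → ℝ) →ₗ[ℝ] ℝ).prod (LinearMap.proj k'))
  have hS : ∀ s k k', k ≠ k' → (S k k').map (L s) ≠ ⊤ := by
    classical
    intro s k k' hkk' htop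
    have hle := Submodule.finrank_map_le (L s) (S k k')
    have hsurj : Function.Surjective
        ((LinearMap.proj k : (κ → ℝ) →ₗ[ℝ] ℝ).prod (LinearMap.proj k')) := fun ⟨a, b⟩ =>
      ⟨fun i => if i = k then a else b, by simp [hkk'.symm]⟩
    have hrk := LinearMap.finrank_range_add_finrank_ker
      ((LinearMap.proj k : (κ → ℝ) →ₗ[ℝ] ℝ).prod (LinearMap.proj k'))
    rw [LinearMap.range_eq_top.2 hsurj, finrank_top, Module.finrank_prod, Module.finrank_self,
      Module.finrank_fintype_fun_eq_card] at hrk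
    rw [htop, finrank_top] at hle
    simp only [S] at hle
    omega
  have hae : ∀ s k k', ∀ᵐ v ∂(MeasureTheory.Measure.addHaar : MeasureTheory.Measure E),
      k ≠ k' → v ∉ (S k k').map (L s) := by
    intro s k k'
    by_cases hkk' : k = k'
    · simp [hkk']
    · filter_upwards [MeasureTheory.measure_eq_zero_iff_ae_notMem.1
        (MeasureTheory.Measure.addHaar_submodule MeasureTheory.Measure.addHaar _
          (hS s k k' hkk'))] with v hv _ using hv
  filter_upwards [MeasureTheory.ae_all_iff.2 fun s => MeasureTheory.ae_all_iff.2 fun k =>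
    MeasureTheory.ae_all_iff.2 (hae s k)] with v hv s c k k' hc hk hk'
  by_contra hne
  exact hv s k k' hne ⟨c, by simp [S, hk, hk'], hc⟩

theorem dense_iUnion_complementary_cones {ι E : Type*} [Fintype ι] [NormedAddCommGroup E]
    [NormedSpace ℝ E] [FiniteDimensional ℝ E] (hcard : Fintype.card ι = Module.finrank ℝ E)
    {p q : ι → E} {w : ι → ℝ} {y : E} (hp : LinearIndependent ℝ p) (hw : ∀ i, 0 < w i)
    (hy : ∑ i, w i • p i = y)
    (hray : ∀ (σ : ι → Bool) (c : ι → ℝ) (z : ℝ), 0 ≤ c → 0 ≤ z →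
      ∑ i, c i • (bif σ i then p i else q i) = z • y → (c = 0 ∧ z = 0) ∨ ∀ i, σ i = true) :
    Dense {v : E | ∃ (σ : ι → Bool) (c : ι → ℝ), 0 ≤ c ∧
      ∑ i, c i • (bif σ i then p i else q i) = v} := by
  classical
  let L : (ι → Bool) → (Option ι → ℝ) →ₗ[ℝ] E := fun σ =>
    Fintype.linearCombination ℝ fun k : Option ι =>
      k.elim (-y) fun i => bif σ i then p i else q i
  have hL : ∀ σ c, L σ c =
      -(c none • y) + ∑ i, c (some i) • (bif σ i then p i else q i) := by
    intro σ c
    simp [L, Fintype.linearCombination_apply, Fintype.sum_option]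
  refine (dense_isGenericValue (by simp [hcard]) L).mono fun v hv => ?_
  suffices h : ∃ σ, MeetsFacet (L σ) v none by
    obtain ⟨σ, c, hc, hc0, hLc⟩ := h
    refine ⟨σ, fun i => c (some i), fun i => hc _, ?_⟩
    simpa [hL, hc0] using hLc
  have hodd : ∀ σ, ((Finset.univ.filter (MeetsFacet (L σ) v)).card : ZMod 2) =
      if σ = fun _ => true then 1 else 0 := by
    intro σ
    split_ifs with hσ
    · rw [(hv σ).card_meetsFacet_eq_one, Nat.cast_one]
      · refine ⟨fun k => k.elim 1 w, ?_, fun h => ?_, ?_⟩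
        · rintro (_ | i)
          · simp
          · exact (hw i).le
        · simpa using congrFun h none
        · simp [hL, hσ, hy]
      · have hspan := hp.span_eq_top_of_card_eq_finrank' hcard
        obtain ⟨b, hb⟩ := (Submodule.mem_span_range_iff_exists_fun ℝ).1
          (hspan ▸ Submodule.mem_top : v ∈ Submodule.span ℝ (Set.range p))
        have hpos : ∀ i, 0 ≤ |b i| / w i := fun i => div_nonneg (abs_nonneg _) (hw i).le
        refine ⟨fun k => k.elim (∑ i, |b i| / w i)
          fun i => b i + (∑ j, |b j| / w j) * w i, ?_, ?_⟩
        · rintro (_ | i)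
          · exact Finset.sum_nonneg fun i _ => hpos i
          · have h1 := Finset.single_le_sum (fun j _ => hpos j) (Finset.mem_univ i)
            rw [div_le_iff₀ (hw i)] at h1
            have := neg_abs_le (b i)
            simp only [Pi.zero_apply, Option.elim_some]
            linarith
        · simp [hL, hσ, add_smul, Finset.sum_add_distrib, mul_smul, ← Finset.smul_sum, hy, hb]
    · rw [ZMod.natCast_eq_zero_iff_even]
      refine (hv σ).even_card_meetsFacet ?_ fun n hn hLn => ?_
      · obtain ⟨n, hn, hn0⟩ := Submodule.exists_mem_ne_zero_of_ne_bot
          (LinearMap.ker_ne_bot_of_finrank_lt (f := L σ) (by simp [hcard]))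
        exact ⟨n, hn0, hn⟩
      · rw [hL, neg_add_eq_zero] at hLn
        rcases hray σ (fun i => n (some i)) (n none) (fun i => hn _) (hn _) hLn.symm with h | h
        · ext (_ | i)
          · exact h.2
          · exact congrFun h.1 i
        · exact absurd (funext h) hσ
  have hpair : ∀ i, ∑ σ, (if MeetsFacet (L σ) v (some i) then 1 else 0 : ZMod 2) = 0 := by
    intro i
    refine Finset.sum_ninvolution (fun σ => Function.update σ i (!σ i)) (fun σ => ?_)
      (fun σ _ h => ?_) (fun _ => Finset.mem_univ _) (fun σ => by simp)
    · have : MeetsFacet (L (Function.update σ i (!σ i))) v (some i) ↔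
          MeetsFacet (L σ) v (some i) := by
        refine exists_congr fun c => and_congr_right fun _ => and_congr_right fun hc => ?_
        rw [hL, hL, Finset.sum_congr rfl fun j _ => ?_]
        by_cases hj : j = i
        · simp [hj, hc]
        · simp [hj]
      simp only [this]
      exact CharTwo.add_self_eq_zero _
    · have := congrFun h i
      simp at this
  by_contra! hnone
  have hsum : ∑ σ, ((Finset.univ.filter (MeetsFacet (L σ) v)).card : ZMod 2) = 0 := by
    simp_rw [Finset.card_filter, Nat.cast_sum, Nat.cast_ite, Nat.cast_one, Nat.cast_zero]
    rw [Finset.sum_comm, Fintype.sum_option]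
    simp [hpair, hnone]
  simp [hodd] at hsum

theorem inner_self_le_inner_of_forall_norm_le {E : Type*} [NormedAddCommGroup E]
    [InnerProductSpace ℝ E] {K : Set E} (hK : Convex ℝ K) {y : E} (hy : y ∈ K)
    (hmin : ∀ z ∈ K, ‖y‖ ≤ ‖z‖) {z : E} (hz : z ∈ K) : inner ℝ y y ≤ inner ℝ y z := by
  have : Nonempty K := ⟨⟨y, hy⟩⟩
  have hinf : ‖(0 : E) - y‖ = ⨅ z : K, ‖(0 : E) - z‖ := by
    simp only [zero_sub, norm_neg]
    exact le_antisymm (le_ciInf fun z => hmin z z.2)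
      (ciInf_le ⟨0, by rintro _ ⟨z, rfl⟩; exact norm_nonneg _⟩ (⟨y, hy⟩ : K))
  have := (norm_eq_iInf_iff_real_inner_le_zero hK hy).1 hinf z hz
  rw [zero_sub, inner_neg_left, inner_sub_right] at this
  linarith

theorem exists_zero_mem_convexHull_range {E : Type*} [NormedAddCommGroup E]
    [InnerProductSpace ℝ E] [FiniteDimensional ℝ E] {d : ℕ} (hd : Module.finrank ℝ E = d)
    (P : Fin (d + 1) → Finset E) (hP : ∀ i, (P i).Nonempty)
    (h : ∀ i j, i ≠ j → (0 : E) ∈ convexHull ℝ ((P i : Set E) ∪ P j)) :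
    ∃ p : Fin (d + 1) → E, (∀ i, p i ∈ P i) ∧ (0 : E) ∈ convexHull ℝ (Set.range p) := by
  classical
  by_contra! hno
  -- a point `y` of minimal norm in a colorful simplex
  obtain ⟨y, p, hp, hyp, hmin⟩ : ∃ (y : E) (p : Fin (d + 1) → E), (∀ i, p i ∈ P i) ∧
      y ∈ convexHull ℝ (Set.range p) ∧ ∀ p' : Fin (d + 1) → E, (∀ i, p' i ∈ P i) →
        ∀ z ∈ convexHull ℝ (Set.range p'), ‖y‖ ≤ ‖z‖ := by
    have hcpt : IsCompact (⋃ p ∈ Fintype.piFinset P, convexHull ℝ (Set.range p)) :=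
      (Fintype.piFinset P).isCompact_biUnion fun p _ =>
        (Set.finite_range p).isCompact_convexHull ℝ
    choose p₀ hp₀ using hP
    obtain ⟨y, hy, hmin⟩ := hcpt.exists_isMinOn
      ⟨p₀ 0, Set.mem_biUnion (by simpa using hp₀ : p₀ ∈ (Fintype.piFinset P : Set _))
        (subset_convexHull ℝ _ ⟨0, rfl⟩)⟩ continuous_norm.continuousOn
    obtain ⟨p, hp, hyp⟩ := Set.mem_iUnion₂.1 hy
    exact ⟨y, p, by simpa using hp, hyp, fun p' hp' z hz =>
      hmin (Set.mem_iUnion₂.2 ⟨p', by simpa using hp', hz⟩)⟩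
  have hy0 : y ≠ 0 := by
    rintro rfl
    exact hno p hp hyp
  have hN : 0 < inner ℝ y y := real_inner_self_pos.2 hy0
  have hinner : ∀ p' : Fin (d + 1) → E, (∀ i, p' i ∈ P i) → y ∈ convexHull ℝ (Set.range p') →
      ∀ i, inner ℝ y y ≤ inner ℝ y (p' i) := fun p' hp' hy i =>
    inner_self_le_inner_of_forall_norm_le (convex_convexHull ℝ _) hy (hmin p' hp')
      (subset_convexHull ℝ _ ⟨i, rfl⟩)
  let Rep : (Fin (d + 1) → ℝ) → Prop := fun w =>
    0 ≤ w ∧ ∑ i, w i = 1 ∧ ∑ i, w i • p i = y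
  -- a color class which is not needed to represent `y` lies beyond the supporting hyperplane
  have hfar : ∀ w, Rep w → ∀ j, w j = 0 → ∀ a ∈ P j, inner ℝ y y ≤ inner ℝ y a := by
    rintro w ⟨hw0, hw1, hwy⟩ j hj a ha
    have := hinner (Function.update p j a) (fun i => ?_)
      (mem_convexHull_range_iff.2 ⟨w, hw0, hw1, ?_⟩) j
    · simpa using this
    · by_cases hij : i = j
      · subst hij; simpa using ha
      · simpa [hij] using hp i
    · rw [← hwy]
      refine Finset.sum_congr rfl fun i _ => ?_
      by_cases hij : i = j
      · simp [hij, hj]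
      · simp [hij]
  have hnear : ∀ i j, i ≠ j → ∃ a ∈ (P i : Set E) ∪ P j, inner ℝ y a ≤ 0 := by
    intro i j hij
    by_contra! hpos
    have hconv : Convex ℝ {a : E | 0 < inner ℝ y a} :=
      convex_halfSpace_gt (innerₛₗ ℝ y).isLinear 0
    have h0 : 0 < inner ℝ y 0 := convexHull_min hpos hconv (h i j hij)
    simp at h0
  have hunique : ∀ w, Rep w → ∀ j k, w j = 0 → w k = 0 → j = k := by
    intro w hw j k hj hk
    by_contra hjk
    obtain ⟨a, ha | ha, ha0⟩ := hnear j k hjk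
    · linarith [hfar w hw j hj a ha]
    · linarith [hfar w hw k hk a ha]
  have hon : ∀ w, Rep w → ∀ i, w i ≠ 0 → inner ℝ y (p i) = inner ℝ y y := by
    rintro w ⟨hw0, hw1, hwy⟩ i hi
    have hnonneg : ∀ i, 0 ≤ w i * (inner ℝ y (p i) - inner ℝ y y) := fun i =>
      mul_nonneg (hw0 i) (sub_nonneg.2 (hinner p hp hyp i))
    have hsum : ∑ i, w i * (inner ℝ y (p i) - inner ℝ y y) = 0 := by
      simp_rw [mul_sub, Finset.sum_sub_distrib, ← Finset.sum_mul, hw1, ← inner_smul_right,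
        ← inner_sum, hwy]
      simp
    have := (Finset.sum_eq_zero_iff_of_nonneg fun i _ => hnonneg i).1 hsum i (Finset.mem_univ i)
    rcases mul_eq_zero.1 this with h | h
    · exact absurd h hi
    · linarith
  have hmove : ∀ w, Rep w → ∀ m : Fin (d + 1) → ℝ, m ≠ 0 → ∑ i, m i • p i = 0 →
      (∀ i, w i = 0 → m i = 0) →
      ∃ t : ℝ, Rep (w + t • m) ∧ ∃ k, m k < 0 ∧ (w + t • m) k = 0 := by
    intro w hw m hm0 hmp hwm
    have hmN : (∑ i, m i) * inner ℝ y y = 0 := by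
      have h0 : inner ℝ y (∑ i, m i • p i) = 0 := by simp [hmp]
      rw [inner_sum] at h0
      rw [← h0, Finset.sum_mul]
      refine Finset.sum_congr rfl fun i _ => ?_
      rw [inner_smul_right]
      by_cases hi : w i = 0
      · simp [hwm i hi]
      · rw [hon w hw i hi]
    have hm1 : ∑ i, m i = 0 := (mul_eq_zero.1 hmN).resolve_right hN.ne'
    have hneg : ∃ i, m i < 0 := by
      by_contra! hpos
      exact hm0 (funext fun i =>
        (Finset.sum_eq_zero_iff_of_nonneg fun i _ => hpos i).1 hm1 i (Finset.mem_univ i))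
    obtain ⟨hw0, hw1, hwy⟩ := hw
    obtain ⟨t, -, ht, k, hk, hk0⟩ := exists_nonneg_add_smul_eq_zero hw0 hneg
    refine ⟨t, ⟨ht, ?_, ?_⟩, k, hk, hk0⟩
    · simp [Finset.sum_add_distrib, ← Finset.mul_sum, hw1, hm1]
    · simp [add_smul, Finset.sum_add_distrib, mul_smul, ← Finset.smul_sum, hwy, hmp]
  obtain ⟨w, hw, j, hj⟩ : ∃ w, Rep w ∧ ∃ j, w j = 0 := by
    obtain ⟨w, hw0, hw1, hwy⟩ := mem_convexHull_range_iff.1 hyp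
    by_contra! hne
    obtain ⟨m, hm, i, hi⟩ := Fintype.not_linearIndependent_iff.1
      (fun hli : LinearIndependent ℝ p => by simpa [hd] using hli.fintype_card_le_finrank)
    obtain ⟨t, ht, k, -, hk⟩ := hmove w ⟨hw0, hw1, hwy⟩ m (fun h0 => hi (by simp [h0])) hm
      fun i hi => absurd hi (hne w ⟨hw0, hw1, hwy⟩ i)
    exact hne _ ht k hk
  have hwpos : ∀ i, 0 < w (j.succAbove i) := fun i =>
    (hw.1 _).lt_of_ne' fun h0 => j.succAbove_ne i (hunique w hw _ _ h0 hj)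
  have hli : LinearIndependent ℝ fun i => p (j.succAbove i) := by
    refine Fintype.linearIndependent_iff.2 fun n hn => ?_
    by_contra! hne
    obtain ⟨i, hi⟩ := hne
    have hmj : (j.insertNth 0 n : Fin (d + 1) → ℝ) j = 0 := by simp
    obtain ⟨t, ht, k, hk, hk0⟩ := hmove w hw (j.insertNth 0 n)
      (fun h0 => hi (by simpa using congrFun h0 (j.succAbove i)))
      (by simpa [Fin.sum_univ_succAbove _ j] using hn)
      (fun k hk => by rw [hunique w hw k j hk hj, hmj])
    have := hunique _ ht k j hk0 (by simp [hj])
    rw [this, hmj] at hk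
    exact hk.false
  have hq : ∀ i, ∃ q ∈ P (j.succAbove i), inner ℝ y q ≤ 0 := by
    intro i
    obtain ⟨a, ha | ha, ha0⟩ := hnear j (j.succAbove i) (j.succAbove_ne i).symm
    · linarith [hfar w hw j hj a ha]
    · exact ⟨a, ha, ha0⟩
  choose q hqP hq0 using hq
  let r : (Fin d → Bool) → Fin d → E := fun σ i => bif σ i then p (j.succAbove i) else q i
  let pick : (Fin d → Bool) → Fin (d + 1) → E := fun σ => j.insertNth (p j) (r σ)
  have hpick : ∀ σ i, pick σ i ∈ P i := by
    intro σ i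
    refine j.succAboveCases ?_ (fun i => ?_) i
    · simpa [pick] using hp j
    · cases hσ : σ i <;> simp [pick, r, hσ, hqP, hp]
  have hmem : ∀ σ (a : ℝ) (c : Fin d → ℝ), 0 ≤ a → 0 ≤ c → a + ∑ i, c i = 1 →
      a • p j + ∑ i, c i • r σ i ∈ convexHull ℝ (Set.range (pick σ)) := by
    intro σ a c ha hc hac
    refine mem_convexHull_range_iff.2 ⟨j.insertNth a c, fun i => ?_, ?_, ?_⟩
    · refine j.succAboveCases ?_ (fun i => ?_) i
      · simpa using ha
      · simpa using hc i
    · simpa [Fin.sum_univ_succAbove _ j] using hac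
    · simp [Fin.sum_univ_succAbove _ j, pick]
  have hwy : ∑ i, w (j.succAbove i) • p (j.succAbove i) = y := by
    simpa [Fin.sum_univ_succAbove _ j, hj] using hw.2.2
  have hdense := dense_iUnion_complementary_cones (q := q) (by simp [hd]) hli hwpos hwy (by
    intro σ c z hc hz hcz
    change ∑ i, c i • r σ i = z • y at hcz
    rcases (Finset.sum_nonneg fun i (_ : i ∈ Finset.univ) => hc i).eq_or_lt with hS | hS
    · have hc0 : c = 0 := funext fun i =>
        (Finset.sum_eq_zero_iff_of_nonneg fun i _ => hc i).1 hS.symm i (Finset.mem_univ i)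
      exact Or.inl ⟨hc0, by simpa [hc0, hy0, eq_comm] using hcz⟩
    right
    have hSz : ∑ i, c i ≤ z := by
      have h1 := hmin _ (hpick σ) _ (hmem σ 0 (fun i => c i / ∑ i, c i) le_rfl
        (fun i => div_nonneg (hc i) hS.le) (by rw [← Finset.sum_div, div_self hS.ne', zero_add]))
      simp_rw [div_eq_inv_mul, mul_smul, ← Finset.smul_sum, hcz] at h1
      rw [zero_smul, zero_add, smul_smul, norm_smul, Real.norm_of_nonneg (by positivity),
        le_mul_iff_one_le_left (norm_pos_iff.2 hy0), ← div_eq_inv_mul, one_le_div hS] at h1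
      exact h1
    have hle : ∀ i, inner ℝ y (r σ i) ≤ inner ℝ y y := by
      intro i
      cases hσ : σ i
      · simpa [r, hσ] using (hq0 i).trans hN.le
      · simpa [r, hσ] using (hon w hw _ (hwpos i).ne').le
    have hnonneg : ∀ i, 0 ≤ c i * (inner ℝ y y - inner ℝ y (r σ i)) := fun i =>
      mul_nonneg (hc i) (sub_nonneg.2 (hle i))
    have hsum : ∑ i, c i * (inner ℝ y y - inner ℝ y (r σ i)) = 0 := by
      refine le_antisymm ?_ (Finset.sum_nonneg fun i _ => hnonneg i)
      have hcr : ∑ i, c i * inner ℝ y (r σ i) = z * inner ℝ y y := by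
        rw [← real_inner_smul_right, ← hcz, inner_sum]
        simp_rw [real_inner_smul_right]
      simp_rw [mul_sub, Finset.sum_sub_distrib, ← Finset.sum_mul, hcr]
      exact sub_nonpos.2 (mul_le_mul_of_nonneg_right hSz hN.le)
    have hc0 : ∀ i, σ i = false → c i = 0 := by
      intro i hi
      have h1 := (Finset.sum_eq_zero_iff_of_nonneg fun i _ => hnonneg i).1 hsum i
        (Finset.mem_univ i)
      refine (mul_eq_zero.1 h1).resolve_right ?_
      have := hq0 i
      simp only [r, hi, cond_false]
      linarith
    have hcp : ∑ i, (c i - z * w (j.succAbove i)) • p (j.succAbove i) = 0 := by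
      simp_rw [sub_smul, Finset.sum_sub_distrib, mul_smul, ← Finset.smul_sum, hwy]
      rw [← hcz, sub_eq_zero]
      refine Finset.sum_congr rfl fun i _ => ?_
      cases hσ : σ i
      · simp [hc0 i hσ]
      · simp [r, hσ]
    intro i
    by_contra hi
    have h1 := Fintype.linearIndependent_iff.1 hli _ hcp i
    rw [hc0 i (by simpa using hi)] at h1
    have := mul_pos (hS.trans_le hSz) (hwpos i)
    linarith)
  have hclosed : IsClosed (⋃ σ, convexHull ℝ (Set.range (pick σ))) :=
    isClosed_iUnion_of_finite fun σ => ((Set.finite_range _).isCompact_convexHull ℝ).isClosed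
  obtain ⟨ε, hε, hball⟩ := Metric.isOpen_iff.1 hclosed.isOpen_compl 0 (by
    simpa using fun σ => hno _ (hpick σ))
  obtain ⟨v, ⟨σ, c, hc, hcv⟩, hv⟩ := hdense.exists_dist_lt (-p j) hε
  change ∑ i, c i • r σ i = v at hcv
  have hS : 0 ≤ ∑ i, c i := Finset.sum_nonneg fun i _ => hc i
  have hz := hmem σ (1 + ∑ i, c i)⁻¹ (fun i => (1 + ∑ i, c i)⁻¹ * c i) (by positivity)
    (fun i => mul_nonneg (by positivity) (hc i)) (by rw [← Finset.mul_sum]; field_simp)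
  simp_rw [mul_smul, ← Finset.smul_sum, hcv, ← smul_add] at hz
  refine hball ?_ (Set.mem_iUnion.2 ⟨σ, hz⟩)
  rw [mem_ball_zero_iff, norm_smul, Real.norm_of_nonneg (by positivity)]
  rw [dist_eq_norm, ← norm_neg, neg_sub, sub_neg_eq_add, add_comm] at hv
  exact (mul_le_of_le_one_left (norm_nonneg _) (inv_le_one_of_one_le₀ (by linarith))).trans_lt hv

/-- **Strong Colorful Carathéodory theorem.** If `x` lies in the convex hull of
`Pᵢ ∪ Pⱼ` for every pair `i < j` of non-empty finite point sets `P₁, …, P_{d+1}`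
in `ℝ^d`, then one can choose one point `pᵢ ∈ Pᵢ` from each set so that
`x ∈ conv {p₁, …, p_{d+1}}`. -/
theorem strong_colorful_caratheodory (d : ℕ)
    (P : Fin (d + 1) → Finset (EuclideanSpace ℝ (Fin d)))
    (hP : ∀ i, (P i).Nonempty)
    (x : EuclideanSpace ℝ (Fin d))
    (hx : ∀ i j : Fin (d + 1), i < j →
      x ∈ convexHull ℝ ((P i : Set (EuclideanSpace ℝ (Fin d))) ∪ ↑(P j))) :
    ∃ p : Fin (d + 1) → EuclideanSpace ℝ (Fin d),
      (∀ i, p i ∈ P i) ∧ x ∈ convexHull ℝ (Set.range p) := by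
  classical
  have hsub : ∀ s : Set (EuclideanSpace ℝ (Fin d)), x ∈ convexHull ℝ s →
      0 ∈ convexHull ℝ ((fun a => a - x) '' s) := by
    intro s hs
    rw [← Set.sub_singleton, convexHull_sub, convexHull_singleton]
    exact ⟨x, hs, x, rfl, sub_self x⟩
  obtain ⟨p, hp, hp0⟩ := exists_zero_mem_convexHull_range (by simp)
    (fun i => (P i).image fun a => a - x) (fun i => (hP i).image _) (fun i j hij => by
      simp only [Finset.coe_image, ← Set.image_union]
      rcases hij.lt_or_gt with h | h
      · exact hsub _ (hx i j h)
      · rw [Set.union_comm]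
        exact hsub _ (hx j i h))
  refine ⟨fun i => p i + x, fun i => ?_, ?_⟩
  · obtain ⟨a, ha, hax⟩ := Finset.mem_image.1 (hp i)
    simpa [← hax] using ha
  · obtain ⟨w, hw0, hw1, hwp⟩ := mem_convexHull_range_iff.1 hp0
    refine mem_convexHull_range_iff.2 ⟨w, hw0, hw1, ?_⟩
    simp [smul_add, Finset.sum_add_distrib, ← Finset.sum_smul, hw1, hwp]
end

section
/- Let X be a simplicial complex on finite vertex set V with V ∉ X, let S ⊆ V with S ∉ X^⋆, and let T = V − S. Then H̃_i(X^⋆[S]; ℚ) ≅ H̃_{|S|−i−3}(lk(T, X); ℚ) for all i. -/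
/-- An abstract simplicial complex on vertex type `V` (containing the empty face). -/
structure SimplicialCpx (V : Type*) where
  faces : Set (Finset V)
  down_closed : ∀ s ∈ faces, ∀ t ⊆ s, t ∈ faces
  empty_mem : (∅ : Finset V) ∈ faces

namespace SimplicialCpx

variable {V : Type*}

/-- `n`-dimensional chains: formal ℚ-linear combinations of faces of cardinality `n`
(the degree is shifted by one from the usual convention: cardinality `n` faces
have topological dimension `n - 1`; cardinality `0` chains are spanned by the
empty face, giving *reduced* homology). -/
abbrev Chain (X : SimplicialCpx V) (n : ℕ) : Type _ :=
  {s : Finset V // s ∈ X.faces ∧ s.card = n} →₀ ℚ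

variable [LinearOrder V]

/-- The simplicial boundary map, from chains on cardinality `n+1` faces to chains on
cardinality `n` faces, with signs determined by the linear order on the vertices. -/
noncomputable def bdry (X : SimplicialCpx V) (n : ℕ) :
    X.Chain (n + 1) →ₗ[ℚ] X.Chain n :=
  Finsupp.lsum ℚ fun s => LinearMap.toSpanSingleton ℚ (X.Chain n)
    (∑ v ∈ s.1.attach, ((-1 : ℚ) ^ (s.1.filter (· < v.1)).card) •
      Finsupp.single ⟨s.1.erase v.1,
        ⟨X.down_closed _ s.2.1 _ (Finset.erase_subset _ _), by
          rw [Finset.card_erase_of_mem v.2, s.2.2]; rfl⟩⟩ (1 : ℚ))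

/-- The cycles of cardinality `n`: all chains for `n = 0`, kernel of the boundary otherwise. -/
noncomputable def cycles (X : SimplicialCpx V) : (n : ℕ) → Submodule ℚ (X.Chain n)
  | 0 => ⊤
  | (m + 1) => LinearMap.ker (X.bdry m)

/-- Reduced simplicial homology with rational coefficients, indexed so that
`X.redH n` is the reduced homology group `H̃_{n-1}(X; ℚ)` in the usual topological
indexing (thus `X.redH 0 = H̃_{-1}`). -/
noncomputable def redH (X : SimplicialCpx V) (n : ℕ) : Type _ :=
  (X.cycles n) ⧸ (Submodule.comap (X.cycles n).subtype (LinearMap.range (X.bdry n)))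

noncomputable instance (X : SimplicialCpx V) (n : ℕ) : AddCommGroup (X.redH n) :=
  inferInstanceAs (AddCommGroup ((X.cycles n) ⧸ _))

noncomputable instance (X : SimplicialCpx V) (n : ℕ) : Module ℚ (X.redH n) :=
  inferInstanceAs (Module ℚ ((X.cycles n) ⧸ _))

/-- `η(X) = min { j : H̃_j(X;ℚ) ≠ 0 } + 1`, which in our shifted indexing is
`min { n : X.redH n ≠ 0 }`; it is `⊤` if all reduced homology vanishes. -/
noncomputable def eta (X : SimplicialCpx V) : ℕ∞ :=
  sInf {n : ℕ∞ | ∃ m : ℕ, n = (m : ℕ∞) ∧ Nontrivial (X.redH m)}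

/-- The induced subcomplex on a vertex subset `S`. -/
def induce (X : SimplicialCpx V) (S : Set V) : SimplicialCpx V where
  faces := {t | t ∈ X.faces ∧ ↑t ⊆ S}
  down_closed := fun s hs t hts =>
    ⟨X.down_closed s hs.1 t hts, subset_trans (by exact_mod_cast hts) hs.2⟩
  empty_mem := ⟨X.empty_mem, by simp⟩

/-- The link of a face `T` in `X`. -/
def link (X : SimplicialCpx V) (T : Finset V) (hT : T ∈ X.faces) : SimplicialCpx V where
  faces := {R | Disjoint R T ∧ R ∪ T ∈ X.faces}
  down_closed := fun s hs t hts =>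
    ⟨Finset.disjoint_of_subset_left hts hs.1,
     X.down_closed _ hs.2 _ (Finset.union_subset_union_left hts)⟩
  empty_mem := ⟨Finset.disjoint_empty_left T, by simpa using hT⟩

/-- The Alexander dual `X^⋆ = { T ⊆ V : V - T ∉ X }` (a simplicial complex provided
the full vertex set is not a face of `X`). -/
def dual [Fintype V] [DecidableEq V] (X : SimplicialCpx V)
    (h : (Finset.univ : Finset V) ∉ X.faces) : SimplicialCpx V where
  faces := {T | Finset.univ \ T ∉ X.faces}
  down_closed := fun s hs t hts hmem =>
    hs (X.down_closed _ hmem _ (Finset.sdiff_subset_sdiff (subset_refl _) hts))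
  empty_mem := by simpa using h

end SimplicialCpx

namespace SimplicialCpx

variable {V : Type*} [LinearOrder V] [Fintype V]

/-- The boundary matrix of the full simplex on `V`: the entry at `(s, t)` is the coefficient of
`s` in the boundary of `t`. -/
def incidence (V : Type*) [LinearOrder V] [Fintype V] : Matrix (Finset V) (Finset V) ℚ :=
  fun s t => ∑ v, if v ∉ s ∧ insert v s = t then (-1) ^ (s.filter (· < v)).card else 0

open Matrix

lemma incidence_mulVec (f : Finset V → ℚ) (s : Finset V) :
    (incidence V *ᵥ f) s =
      ∑ v, if v ∉ s then (-1) ^ (s.filter (· < v)).card * f (insert v s) else 0 := by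
  simp only [Matrix.mulVec, dotProduct, incidence, Finset.sum_mul]
  rw [Finset.sum_comm]
  refine Finset.sum_congr rfl fun v _ => ?_
  by_cases hv : v ∈ s <;> simp [hv]

lemma incidence_apply_eq_sum_erase (s t : Finset V) :
    incidence V s t =
      ∑ v ∈ t, if t.erase v = s then (-1) ^ (t.filter (· < v)).card else 0 := by
  rw [incidence, ← Finset.sum_subset (Finset.subset_univ t)]
  · refine Finset.sum_congr rfl fun v hv => ?_
    have : (v ∉ s ∧ insert v s = t) ↔ t.erase v = s := by
      constructor
      · rintro ⟨h, rfl⟩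
        exact Finset.erase_insert h
      · rintro rfl
        exact ⟨Finset.notMem_erase v t, Finset.insert_erase hv⟩
    simp only [this]
    split_ifs with h
    · subst h
      congr 2
      ext w
      simp only [Finset.mem_filter, Finset.mem_erase]
      grind
    · rfl
  · intro v _ hv
    rw [if_neg]
    rintro ⟨_, rfl⟩
    exact hv (Finset.mem_insert_self _ _)

omit [Fintype V] in
lemma card_filter_lt_insert {s : Finset V} {v : V} (hv : v ∉ s) (w : V) :
    ((insert v s).filter (· < w)).card =
      (s.filter (· < w)).card + if v < w then 1 else 0 := by
  rw [Finset.filter_insert]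
  split_ifs with h
  · rw [Finset.card_insert_of_notMem (by simp [hv])]
  · rfl

lemma incidence_mulVec_mulVec (f : Finset V → ℚ) : incidence V *ᵥ (incidence V *ᵥ f) = 0 := by
  ext s
  have key : ∀ v w, (if v ∉ s then (-1 : ℚ) ^ (s.filter (· < v)).card *
        (if w ∉ insert v s then (-1) ^ ((insert v s).filter (· < w)).card *
          f (insert w (insert v s)) else 0) else 0) =
      -(if w ∉ s then (-1 : ℚ) ^ (s.filter (· < w)).card *
        (if v ∉ insert w s then (-1) ^ ((insert w s).filter (· < v)).card *
          f (insert v (insert w s)) else 0) else 0) := by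
    intro v w
    by_cases hv : v ∈ s
    · simp [hv]
    by_cases hw : w ∈ s
    · simp [hw]
    rcases lt_trichotomy v w with h | rfl | h
    · simp [hv, hw, h.ne, h.ne', card_filter_lt_insert, h, h.not_gt, Finset.insert_comm v w s]
      ring
    · simp
    · simp [hv, hw, h.ne, h.ne', card_filter_lt_insert, h, h.not_gt, Finset.insert_comm v w s]
      ring
  have expand : (incidence V *ᵥ (incidence V *ᵥ f)) s =
      ∑ v, ∑ w, (if v ∉ s then (-1 : ℚ) ^ (s.filter (· < v)).card *
        (if w ∉ insert v s then (-1) ^ ((insert v s).filter (· < w)).card *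
          f (insert w (insert v s)) else 0) else 0) := by
    rw [incidence_mulVec]
    refine Finset.sum_congr rfl fun v _ => ?_
    rw [incidence_mulVec]
    by_cases hv : v ∈ s
    · simp [hv]
    · simp only [hv, not_false_eq_true, if_true, Finset.mul_sum]
  have neg : (incidence V *ᵥ (incidence V *ᵥ f)) s =
      -(incidence V *ᵥ (incidence V *ᵥ f)) s := by
    conv_lhs => rw [expand, Finset.sum_comm]
    rw [expand, ← Finset.sum_neg_distrib]
    refine Finset.sum_congr rfl fun w _ => ?_
    rw [← Finset.sum_neg_distrib]
    exact Finset.sum_congr rfl fun v _ => key v w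
  simpa using self_eq_neg.mp neg

/-- The functions on `Finset V` vanishing off the predicate `p`. -/
def supported (p : Finset V → Prop) : Submodule ℚ (Finset V → ℚ) where
  carrier := {f | ∀ s, ¬ p s → f s = 0}
  add_mem' hf hg s hs := by simp [hf s hs, hg s hs]
  zero_mem' _ _ := rfl
  smul_mem' c f hf s hs := by simp [hf s hs]

omit [LinearOrder V] [Fintype V] in
lemma mem_supported {p : Finset V → Prop} {f : Finset V → ℚ} :
    f ∈ supported p ↔ ∀ s, ¬ p s → f s = 0 := Iff.rfl

lemma exists_incidence_mulVec_eq {S : Finset V} (hS : S.Nonempty) {n : ℕ} {f : Finset V → ℚ}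
    (hf : f ∈ supported fun s => s ⊆ S ∧ s.card = n) (hf0 : incidence V *ᵥ f = 0) :
    ∃ g ∈ supported fun s => s ⊆ S ∧ s.card = n + 1, incidence V *ᵥ g = f := by
  set a := S.min' hS
  have ha : a ∈ S := S.min'_mem hS
  have hmin : ∀ w ∈ S, a ≤ w := fun w hw => S.min'_le w hw
  rw [mem_supported] at hf
  refine ⟨fun t => if a ∈ t then f (t.erase a) else 0, ?_, ?_⟩
  · intro t ht
    dsimp only
    split_ifs with hat
    · refine hf _ fun h => ht ⟨?_, ?_⟩
      · rw [← Finset.insert_erase hat]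
        exact Finset.insert_subset ha h.1
      · rw [← h.2, Finset.card_erase_add_one hat]
    · rfl
  · ext s
    rw [incidence_mulVec]
    by_cases has : a ∈ s
    · have h0 := congrFun hf0 (s.erase a)
      rw [incidence_mulVec, ← Finset.add_sum_erase _ _ (Finset.mem_univ a)] at h0
      rw [← Finset.add_sum_erase _ _ (Finset.mem_univ a)]
      have hcard : f s ≠ 0 → ((s.erase a).filter (· < a)).card = 0 := by
        intro hfs
        have hs : s ⊆ S := by by_contra hs; exact hfs (hf s fun h => hs h.1)
        rw [Finset.card_eq_zero, Finset.filter_eq_empty_iff]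
        intro w hw
        exact not_lt.mpr (hmin w (hs (Finset.mem_of_mem_erase hw)))
      have h1 : (-1) ^ ((s.erase a).filter (· < a)).card * f s = f s := by
        by_cases hfs : f s = 0
        · simp [hfs]
        · simp [hcard hfs]
      simp only [Finset.notMem_erase, not_false_eq_true, if_true, Finset.insert_erase has, h1,
        Pi.zero_apply] at h0
      simp only [has, not_true, if_false, zero_add]
      rw [eq_neg_of_add_eq_zero_left h0, ← Finset.sum_neg_distrib]
      refine Finset.sum_congr rfl fun v hv => ?_
      have hva : v ≠ a := Finset.ne_of_mem_erase hv
      by_cases hvs : v ∈ s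
      · simp [hvs, hva]
      have hins : (insert v s).erase a = insert v (s.erase a) :=
        Finset.erase_insert_of_ne hva
      simp only [hvs, not_false_eq_true, if_true, Finset.mem_insert, has, or_true, hins,
        Finset.mem_erase, and_false]
      by_cases hvS : v ∈ S
      · have := card_filter_lt_insert (Finset.notMem_erase a s) v
        rw [Finset.insert_erase has, if_pos (lt_of_le_of_ne (hmin v hvS) hva.symm)] at this
        rw [this]
        ring
      · rw [hf _ fun h => hvS (h.1 (Finset.mem_insert_self _ _))]
        simp
    · rw [Finset.sum_eq_single a]
      · simp only [has, not_false_eq_true, if_true, Finset.mem_insert, true_or,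
          Finset.erase_insert]
        by_cases hs : s ⊆ S
        · have : s.filter (· < a) = ∅ := by
            rw [Finset.filter_eq_empty_iff]
            exact fun w hw => not_lt.mpr (hmin w (hs hw))
          simp [this]
        · rw [hf s fun h => hs h.1, mul_zero]
      · intro v _ hva
        simp [has, hva.symm]
      · simp

open Classical in
/-- Restriction of a function to a predicate, extended by zero. -/
noncomputable def cut (p : Finset V → Prop) : (Finset V → ℚ) →ₗ[ℚ] (Finset V → ℚ) where
  toFun f s := if p s then f s else 0
  map_add' f g := by ext s; by_cases h : p s <;> simp [h]
  map_smul' c f := by ext s; by_cases h : p s <;> simp [h]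

open Classical in
omit [LinearOrder V] [Fintype V] in
lemma cut_apply (p : Finset V → Prop) (f : Finset V → ℚ) (s : Finset V) :
    cut p f s = if p s then f s else 0 := rfl

omit [LinearOrder V] [Fintype V] in
lemma cut_mem_supported (p : Finset V → Prop) (f : Finset V → ℚ) : cut p f ∈ supported p :=
  fun s hs => by simp [cut_apply, hs]

omit [LinearOrder V] [Fintype V] in
lemma cut_eq_self {p : Finset V → Prop} {f : Finset V → ℚ} (hf : f ∈ supported p) :
    cut p f = f := by
  ext s
  by_cases h : p s
  · simp [cut_apply, h]
  · simp [cut_apply, h, hf s h]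

omit [LinearOrder V] [Fintype V] in
lemma supported_mono {p q : Finset V → Prop} (h : ∀ s, p s → q s) :
    supported p ≤ supported q :=
  fun _ hf s hs => hf s fun hp => hs (h s hp)

open Classical in
/-- The incidence matrix with all rows off `p` and all columns off `q` replaced by zero. -/
noncomputable def mask (p q : Finset V → Prop) : Matrix (Finset V) (Finset V) ℚ :=
  fun s t => if p s ∧ q t then incidence V s t else 0

open Classical in
lemma mask_apply (p q : Finset V → Prop) (s t : Finset V) :
    mask p q s t = if p s ∧ q t then incidence V s t else 0 := rfl

lemma mask_mulVec (p q : Finset V → Prop) (f : Finset V → ℚ) :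
    mask p q *ᵥ f = cut p (incidence V *ᵥ cut q f) := by
  ext s
  simp only [Matrix.mulVec, dotProduct, mask_apply, cut_apply]
  by_cases hp : p s
  · rw [if_pos hp]
    refine Finset.sum_congr rfl fun t _ => ?_
    by_cases hq : q t <;> simp [hp, hq]
  · simp [hp]

lemma incidence_mulVec_mem_supported {p q : Finset V → Prop}
    (h : ∀ t, q t → ∀ v ∈ t, p (t.erase v)) {f : Finset V → ℚ} (hf : f ∈ supported q) :
    incidence V *ᵥ f ∈ supported p := by
  intro s hs
  rw [incidence_mulVec]
  refine Finset.sum_eq_zero fun v _ => ?_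
  by_cases hv : v ∈ s
  · simp [hv]
  · rw [if_pos hv, hf, mul_zero]
    intro hq
    have := h _ hq v (Finset.mem_insert_self _ _)
    rw [Finset.erase_insert hv] at this
    exact hs this

lemma map_supported_eq_range_mask {p q : Finset V → Prop}
    (h : ∀ t, q t → ∀ v ∈ t, p (t.erase v)) :
    (supported q).map (incidence V).mulVecLin = LinearMap.range (mask p q).mulVecLin := by
  ext g
  simp only [Submodule.mem_map, LinearMap.mem_range, Matrix.mulVecLin_apply, mask_mulVec]
  constructor
  · rintro ⟨f, hf, rfl⟩
    exact ⟨f, by rw [cut_eq_self hf, cut_eq_self (incidence_mulVec_mem_supported h hf)]⟩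
  · rintro ⟨f, rfl⟩
    exact ⟨cut q f, cut_mem_supported q f,
      (cut_eq_self (incidence_mulVec_mem_supported h (cut_mem_supported q f))).symm⟩

lemma _root_.Submodule.finrank_inf_ker_add_finrank_map {K E F : Type*} [Field K]
    [AddCommGroup E] [Module K E] [FiniteDimensional K E] [AddCommGroup F] [Module K F]
    (R : Submodule K E) (f : E →ₗ[K] F) :
    Module.finrank K ↥(R ⊓ LinearMap.ker f) + Module.finrank K (R.map f) =
      Module.finrank K R := by
  have h := (f.domRestrict R).finrank_range_add_finrank_ker
  rw [LinearMap.range_domRestrict, LinearMap.ker_domRestrict, add_comm] at h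
  rwa [← (Submodule.comapSubtypeEquivOfLe (p := R ⊓ LinearMap.ker f) inf_le_left).finrank_eq,
    Submodule.comap_inf, Submodule.comap_subtype_self, top_inf_eq]

/-- The subsets of `S` of cardinality `n`. -/
def level (S : Finset V) (n : ℕ) (s : Finset V) : Prop := s ⊆ S ∧ s.card = n

/-- The faces of `Y` of cardinality `n`. -/
def face (Y : SimplicialCpx V) (n : ℕ) (s : Finset V) : Prop := s ∈ Y.faces ∧ s.card = n

/-- The subsets of `S` of cardinality `n` that are not faces of `Y`. -/
def nonface (Y : SimplicialCpx V) (S : Finset V) (n : ℕ) (s : Finset V) : Prop :=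
  level S n s ∧ s ∉ Y.faces

omit [Fintype V] in
lemma level_erase {S : Finset V} {n : ℕ} (t : Finset V) (ht : level S (n + 1) t) (v : V)
    (hv : v ∈ t) : level S n (t.erase v) :=
  ⟨(Finset.erase_subset _ _).trans ht.1, by rw [Finset.card_erase_of_mem hv, ht.2]; rfl⟩

omit [Fintype V] in
lemma face_erase {Y : SimplicialCpx V} {n : ℕ} (t : Finset V) (ht : face Y (n + 1) t) (v : V)
    (hv : v ∈ t) : face Y n (t.erase v) :=
  ⟨Y.down_closed _ ht.1 _ (Finset.erase_subset _ _),
    by rw [Finset.card_erase_of_mem hv, ht.2]; rfl⟩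

lemma finrank_cycles_add_rank {Y : SimplicialCpx V} {S : Finset V} (hS : S.Nonempty)
    (hY : ∀ s ∈ Y.faces, s ⊆ S) (n : ℕ) :
    Module.finrank ℚ ↥(supported (face Y n) ⊓ LinearMap.ker (incidence V).mulVecLin) +
        (mask (nonface Y S n) (level S (n + 1))).rank =
      (mask (level S n) (level S (n + 1))).rank := by
  have hker : LinearMap.range (mask (level S n) (level S (n + 1))).mulVecLin ⊓
      LinearMap.ker (cut (nonface Y S n)) =
      supported (face Y n) ⊓ LinearMap.ker (incidence V).mulVecLin := by
    rw [← map_supported_eq_range_mask level_erase]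
    ext f
    simp only [Submodule.mem_inf, LinearMap.mem_ker, Submodule.mem_map, Matrix.mulVecLin_apply]
    constructor
    · rintro ⟨⟨g, hg, rfl⟩, h0⟩
      refine ⟨fun s hs => ?_, incidence_mulVec_mulVec g⟩
      by_cases hl : level S n s
      · have := congrFun h0 s
        rwa [cut_apply, if_pos ⟨hl, fun h => hs ⟨h, hl.2⟩⟩] at this
      · exact incidence_mulVec_mem_supported level_erase hg s hl
    · rintro ⟨hf, hf0⟩
      refine ⟨exists_incidence_mulVec_eq hS
        (supported_mono (fun s hs => ⟨hY s hs.1, hs.2⟩) hf) hf0, ?_⟩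
      ext s
      rw [cut_apply]
      split_ifs with h
      · exact hf s fun h' => h.2 h'.1
      · rfl
  have hmap : (LinearMap.range (mask (level S n) (level S (n + 1))).mulVecLin).map
      (cut (nonface Y S n)) =
      LinearMap.range (mask (nonface Y S n) (level S (n + 1))).mulVecLin := by
    rw [← map_supported_eq_range_mask level_erase]
    ext f
    simp only [Submodule.mem_map, LinearMap.mem_range, Matrix.mulVecLin_apply, mask_mulVec]
    constructor
    · rintro ⟨_, ⟨g, hg, rfl⟩, rfl⟩
      exact ⟨g, by rw [cut_eq_self hg]⟩
    · rintro ⟨g, rfl⟩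
      exact ⟨_, ⟨_, cut_mem_supported _ g, rfl⟩, rfl⟩
  rw [Matrix.rank, Matrix.rank, ← hker, ← hmap]
  exact Submodule.finrank_inf_ker_add_finrank_map _ _

/-- A chain regarded as a function on all of `Finset V`. -/
noncomputable def chainFun (Y : SimplicialCpx V) (n : ℕ) : Y.Chain n →ₗ[ℚ] (Finset V → ℚ) :=
  (Finsupp.linearEquivFunOnFinite ℚ ℚ (Finset V)).toLinearMap ∘ₗ
    Finsupp.lmapDomain ℚ ℚ Subtype.val

omit [LinearOrder V] in
lemma chainFun_injective (Y : SimplicialCpx V) (n : ℕ) : Function.Injective (chainFun Y n) :=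
  (Finsupp.linearEquivFunOnFinite ℚ ℚ (Finset V)).injective.comp
    (Finsupp.mapDomain_injective Subtype.val_injective)

lemma chainFun_single (Y : SimplicialCpx V) (n : ℕ) (s) (c : ℚ) :
    chainFun Y n (Finsupp.single s c) = Pi.single s.1 c := by
  simp [chainFun, Finsupp.lmapDomain_apply, Finsupp.mapDomain_single]

omit [LinearOrder V] in
lemma range_chainFun (Y : SimplicialCpx V) (n : ℕ) :
    LinearMap.range (chainFun Y n) = supported (face Y n) := by
  apply le_antisymm
  · rintro _ ⟨x, rfl⟩ s hs
    change Finsupp.mapDomain Subtype.val x s = 0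
    refine Finsupp.mapDomain_of_notMem_range _ _ ?_
    rintro ⟨t, rfl⟩
    exact hs t.2
  · intro f hf
    refine ⟨Finsupp.equivFunOnFinite.symm fun s => f s.1, ?_⟩
    ext s
    change Finsupp.mapDomain Subtype.val _ s = f s
    by_cases hs : face Y n s
    · exact Finsupp.mapDomain_apply Subtype.val_injective _ ⟨s, hs⟩
    · rw [hf s hs]
      refine Finsupp.mapDomain_of_notMem_range _ _ ?_
      rintro ⟨t, rfl⟩
      exact hs t.2

lemma chainFun_bdry (Y : SimplicialCpx V) (n : ℕ) (x : Y.Chain (n + 1)) :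
    chainFun Y n (Y.bdry n x) = incidence V *ᵥ chainFun Y (n + 1) x := by
  suffices h : chainFun Y n ∘ₗ Y.bdry n = (incidence V).mulVecLin ∘ₗ chainFun Y (n + 1) from
    LinearMap.congr_fun h x
  refine Finsupp.lhom_ext fun t c => ?_
  simp only [LinearMap.comp_apply, bdry, Finsupp.lsum_single, LinearMap.toSpanSingleton_apply,
    map_smul, map_sum, chainFun_single, Matrix.mulVecLin_apply]
  ext s
  rw [Matrix.mulVec_single, Pi.smul_apply, Pi.smul_apply, Matrix.col_apply,
    incidence_apply_eq_sum_erase, Finset.sum_apply, ← Finset.sum_attach t.1]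
  simp only [smul_eq_mul, MulOpposite.smul_eq_mul_unop, MulOpposite.unop_op]
  rw [mul_comm]
  congr 1
  refine Finset.sum_congr rfl fun v _ => ?_
  simp [Pi.single_apply, eq_comm]

lemma map_chainFun_cycles (Y : SimplicialCpx V) (n : ℕ) :
    (Y.cycles n).map (chainFun Y n) =
      supported (face Y n) ⊓ LinearMap.ker (incidence V).mulVecLin := by
  rw [← range_chainFun]
  cases n with
  | zero =>
    rw [cycles, Submodule.map_top, left_eq_inf]
    rintro _ ⟨x, rfl⟩
    have hx : chainFun Y 0 x ∈ supported (face Y 0) := range_chainFun Y 0 ▸ ⟨x, rfl⟩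
    have := incidence_mulVec_mem_supported (p := fun _ => False) (fun t ht v hv => by
      rw [Finset.card_eq_zero.mp ht.2] at hv
      simp at hv) hx
    ext s
    exact this s not_false
  | succ m =>
    ext f
    simp only [cycles, Submodule.mem_map, LinearMap.mem_ker, Submodule.mem_inf,
      LinearMap.mem_range, Matrix.mulVecLin_apply]
    constructor
    · rintro ⟨x, hx, rfl⟩
      exact ⟨⟨x, rfl⟩, by rw [← chainFun_bdry, hx, map_zero]⟩
    · rintro ⟨⟨x, rfl⟩, hx⟩
      refine ⟨x, chainFun_injective Y m ?_, rfl⟩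
      rw [chainFun_bdry, hx, map_zero]

lemma map_chainFun_range_bdry (Y : SimplicialCpx V) (n : ℕ) :
    (LinearMap.range (Y.bdry n)).map (chainFun Y n) =
      (supported (face Y (n + 1))).map (incidence V).mulVecLin := by
  rw [← range_chainFun, ← LinearMap.range_comp, ← LinearMap.range_comp]
  congr 1
  exact LinearMap.ext (chainFun_bdry Y n)

lemma range_bdry_le_cycles (Y : SimplicialCpx V) (n : ℕ) :
    LinearMap.range (Y.bdry n) ≤ Y.cycles n := by
  rw [← Submodule.map_le_map_iff_of_injective (chainFun_injective Y n), map_chainFun_cycles,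
    map_chainFun_range_bdry]
  rintro _ ⟨f, hf, rfl⟩
  exact ⟨supported_mono (fun _ h => h) (incidence_mulVec_mem_supported face_erase hf),
    incidence_mulVec_mulVec f⟩

instance finite_redH (Y : SimplicialCpx V) (n : ℕ) : Module.Finite ℚ (Y.redH n) :=
  Module.Finite.of_surjective
    (Submodule.mkQ (Submodule.comap (Y.cycles n).subtype (LinearMap.range (Y.bdry n))))
    (Submodule.mkQ_surjective _)

/-- The reduced Betti numbers in terms of ranks of submatrices of the incidence matrix. -/
lemma finrank_redH_add_rank {Y : SimplicialCpx V} {S : Finset V} (hS : S.Nonempty)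
    (hY : ∀ s ∈ Y.faces, s ⊆ S) (n : ℕ) :
    Module.finrank ℚ (Y.redH n) + (mask (level S n) (face Y (n + 1))).rank +
        (mask (nonface Y S n) (level S (n + 1))).rank =
      (mask (level S n) (level S (n + 1))).rank := by
  rw [← finrank_cycles_add_rank hS hY n]
  congr 1
  have hB : (mask (level S n) (face Y (n + 1))).rank =
      Module.finrank ℚ (LinearMap.range (Y.bdry n)) := by
    rw [Matrix.rank, ← map_supported_eq_range_mask (fun t ht => level_erase t ⟨hY t ht.1, ht.2⟩),
      ← map_chainFun_range_bdry, ← (Submodule.equivMapOfInjective _ (chainFun_injective Y n) _).finrank_eq]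
  rw [hB, ← map_chainFun_cycles, ← (Submodule.equivMapOfInjective _ (chainFun_injective Y n) _).finrank_eq,
    ← (Submodule.comapSubtypeEquivOfLe (range_bdry_le_cycles Y n)).finrank_eq]
  exact Submodule.finrank_quotient_add_finrank _

/-- The sign relating the boundary of a subset of `S` to the coboundary of its complement. -/
def complSign (S s : Finset V) : ℚ := ∏ v ∈ s, (-1) ^ (S.filter (· < v)).card

lemma incidence_sdiff {S s t : Finset V} (hs : s ⊆ S) (ht : t ⊆ S) :
    incidence V (S \ t) (S \ s) = complSign S s * complSign S t * incidence V s t := by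
  rw [incidence, incidence, Finset.mul_sum]
  refine Finset.sum_congr rfl fun v _ => ?_
  by_cases h : v ∉ s ∧ insert v s = t
  · obtain ⟨hv, rfl⟩ := h
    have hvS : v ∈ S := ht (Finset.mem_insert_self _ _)
    have h1 : insert v (S \ insert v s) = S \ s := by
      rw [Finset.sdiff_insert, Finset.insert_erase (by simp [hv, hvS])]
    have h2 : ((S \ insert v s).filter (· < v)).card + (s.filter (· < v)).card =
        (S.filter (· < v)).card := by
      rw [← Finset.card_union_of_disjoint]
      · congr 1
        ext w
        simp only [Finset.mem_union, Finset.mem_filter, Finset.mem_sdiff, Finset.mem_insert]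
        grind
      · rw [Finset.disjoint_left]
        simp only [Finset.mem_filter, Finset.mem_sdiff, Finset.mem_insert]
        grind
    have h3 : complSign S s * complSign S s = 1 := by
      rw [complSign, ← Finset.prod_mul_distrib]
      refine Finset.prod_eq_one fun w _ => ?_
      rw [← mul_pow]
      simp
    have h4 : complSign S (insert v s) = (-1) ^ (S.filter (· < v)).card * complSign S s := by
      rw [complSign, Finset.prod_insert hv, complSign]
    rw [if_pos ⟨by simp, h1⟩, if_pos ⟨hv, rfl⟩, h4, ← h2, pow_add]
    have h5 : ((-1 : ℚ) ^ (s.filter (· < v)).card) * (-1) ^ (s.filter (· < v)).card = 1 := by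
      rw [← mul_pow]
      simp
    linear_combination (-((-1 : ℚ) ^ ((S \ insert v s).filter (· < v)).card)) *
      (h3 + complSign S s * complSign S s * h5)
  · rw [if_neg h, if_neg, mul_zero]
    rintro ⟨h1, h2⟩
    apply h
    have hvS : v ∈ S \ s := h2 ▸ Finset.mem_insert_self _ _
    have hvs := (Finset.mem_sdiff.mp hvS).2
    refine ⟨hvs, ?_⟩
    ext w
    have := Finset.ext_iff.mp h2 w
    simp only [Finset.mem_insert, Finset.mem_sdiff] at this h1 hvS ⊢
    have := @hs w
    have := @ht w
    grind

lemma isUnit_det_diagonal_complSign (S : Finset V) :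
    IsUnit (Matrix.diagonal (complSign S)).det := by
  rw [Matrix.det_diagonal, isUnit_iff_ne_zero, Finset.prod_ne_zero_iff]
  intro s _
  rw [complSign, Finset.prod_ne_zero_iff]
  intro v _
  exact pow_ne_zero _ (by norm_num)

lemma rank_mask_sdiff {S : Finset V} {p q p' q' : Finset V → Prop}
    (hp : ∀ s, p s → s ⊆ S) (hq : ∀ s, q s → s ⊆ S)
    (hp' : ∀ s, p' s ↔ s ⊆ S ∧ p (S \ s)) (hq' : ∀ s, q' s ↔ s ⊆ S ∧ q (S \ s)) :
    (mask q' p').rank = (mask p q).rank := by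
  let c : Equiv.Perm (Finset V) := (symmDiff_right_involutive S).toPerm
  have hc : ∀ s ⊆ S, c s = S \ s := fun s hs => by
    change symmDiff S s = _
    rw [symmDiff_of_ge hs]
  have hcS : ∀ s, c s ⊆ S → s ⊆ S := fun s hs => by
    have := hc _ hs
    rw [show c (c s) = s from symmDiff_right_involutive S s] at this
    rw [this]
    exact Finset.sdiff_subset
  have hcompl : ∀ {r r' : Finset V → Prop}, (∀ s, r s → s ⊆ S) →
      (∀ s, r' s ↔ s ⊆ S ∧ r (S \ s)) → ∀ s, r' (c s) ↔ r s := fun hr hr' s => by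
    rw [hr']
    constructor
    · rintro ⟨h1, h2⟩
      have h3 := hcS s h1
      rwa [hc s h3, Finset.sdiff_sdiff_eq_self h3] at h2
    · intro h
      rw [hc s (hr s h), Finset.sdiff_sdiff_eq_self (hr s h)]
      exact ⟨Finset.sdiff_subset, h⟩
  have key : (mask q' p').submatrix c c =
      Matrix.diagonal (complSign S) * (mask p q)ᵀ * Matrix.diagonal (complSign S) := by
    ext t s
    rw [Matrix.mul_diagonal, Matrix.diagonal_mul, Matrix.submatrix_apply, Matrix.transpose_apply,
      mask_apply, mask_apply]
    have hiff : q' (c t) ∧ p' (c s) ↔ p s ∧ q t :=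
      (and_congr (hcompl hq hq' t) (hcompl hp hp' s)).trans and_comm
    by_cases h : p s ∧ q t
    · rw [if_pos (hiff.mpr h), if_pos h, hc s (hp s h.1), hc t (hq t h.2),
        incidence_sdiff (hp s h.1) (hq t h.2)]
      ring
    · rw [if_neg h, if_neg (hiff.not.mpr h)]
      ring
  rw [← Matrix.rank_submatrix (mask q' p') c c, key,
    Matrix.rank_mul_eq_left_of_isUnit_det _ _ (isUnit_det_diagonal_complSign S),
    Matrix.rank_mul_eq_right_of_isUnit_det _ _ (isUnit_det_diagonal_complSign S),
    Matrix.rank_transpose]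

/-- Alexander duality for reduced Betti numbers of complexes with vertices in `S`. -/
theorem finrank_redH_eq_of_dual {K L : SimplicialCpx V} {S : Finset V} (hS : S.Nonempty)
    (hK : ∀ s ∈ K.faces, s ⊆ S) (hL : ∀ s, s ∈ L.faces ↔ s ⊆ S ∧ S \ s ∉ K.faces)
    {n m : ℕ} (hnm : n + m + 1 = S.card) :
    Module.finrank ℚ (L.redH n) = Module.finrank ℚ (K.redH m) := by
  have hKm := finrank_redH_add_rank hS hK m
  have hLn := finrank_redH_add_rank hS (fun s hs => ((hL s).mp hs).1) n
  have hlevel : ∀ i j, i + j = S.card → ∀ s, level S i s ↔ s ⊆ S ∧ level S j (S \ s) := by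
    intro i j hij s
    refine and_congr_right fun hs => ?_
    have := Finset.card_sdiff_add_card_eq_card hs
    simp only [level, Finset.sdiff_subset, true_and]
    lia
  have hface : ∀ i j, i + j = S.card → ∀ s, face L i s ↔ s ⊆ S ∧ nonface K S j (S \ s) := by
    intro i j hij s
    have := hlevel i j hij s
    simp only [face, hL, nonface, level] at this ⊢
    tauto
  have hnonface : ∀ i j, i + j = S.card →
      ∀ s, nonface L S i s ↔ s ⊆ S ∧ face K j (S \ s) := by
    intro i j hij s
    have := hlevel i j hij s
    simp only [face, hL, nonface, level] at this ⊢
    have := hK (S \ s)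
    tauto
  rw [rank_mask_sdiff (p := level S m) (q := level S (m + 1)) (fun _ h => h.1) (fun _ h => h.1)
      (hlevel _ _ (by lia)) (hlevel _ _ (by lia)),
    rank_mask_sdiff (p := nonface K S m) (q := level S (m + 1)) (fun _ h => h.1.1)
      (fun _ h => h.1) (hface _ _ (by lia)) (hlevel _ _ (by lia)),
    rank_mask_sdiff (p := level S m) (q := face K (m + 1)) (fun _ h => h.1)
      (fun _ h => hK _ h.1) (hlevel _ _ (by lia)) (hnonface _ _ (by lia))] at hLn
  lia

end SimplicialCpx

/-- For a simplicial complex `X` on finite vertex set `V` with `V ∉ X`, a subset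
`S ⊆ V` with `S ∉ X^⋆` (equivalently `T = V - S ∈ X`), one has
`H̃ᵢ(X^⋆[S];ℚ) ≅ H̃_{|S|-i-3}(lk(T,X);ℚ)`.  (In our indexing, `redH n` is `H̃_{n-1}`,
so the degrees `i = n - 1` and `|S| - i - 3 = m - 1` correspond to indices with
`n + m + 1 = |S|`.) -/
theorem alexander_duality_link {V : Type*} [LinearOrder V] [Fintype V]
    (X : SimplicialCpx V) (h : (Finset.univ : Finset V) ∉ X.faces)
    (S : Finset V) (hT : Finset.univ \ S ∈ X.faces)
    (n m : ℕ) (hnm : n + m + 1 = S.card) :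
    Nonempty (((X.dual h).induce ↑S).redH n ≃ₗ[ℚ]
      (X.link (Finset.univ \ S) hT).redH m) := by
  apply FiniteDimensional.nonempty_linearEquiv_of_finrank_eq
  have hS : S.Nonempty := Finset.card_pos.mp (by lia)
  refine SimplicialCpx.finrank_redH_eq_of_dual hS (fun R hR v hv => ?_) (fun U => ?_) hnm
  · by_contra hvS
    exact Finset.disjoint_left.mp hR.1 hv (by simpa using hvS)
  · change (Finset.univ \ U ∉ X.faces ∧ (U : Set V) ⊆ S) ↔
      U ⊆ S ∧ ¬ (Disjoint (S \ U) (Finset.univ \ S) ∧ S \ U ∪ Finset.univ \ S ∈ X.faces)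
    rw [Finset.coe_subset, and_comm]
    refine and_congr_right fun hU => ?_
    have hdisj : Disjoint (S \ U) (Finset.univ \ S) :=
      Finset.disjoint_sdiff.mono_left Finset.sdiff_subset
    have hunion : S \ U ∪ Finset.univ \ S = Finset.univ \ U := by
      rw [Finset.union_comm]
      exact Finset.sdiff_union_sdiff_cancel (Finset.subset_univ S) hU
    rw [hunion]
    tauto
end

section
/- Let Z be a simplicial complex on a finite vertex set V partitioned as V = V₁ ∪ ⋯ ∪ V_m. If for every non-empty I ⊆ [m] one has η(Z[⋃_{i∈I} V_i]) ≥ |I|, then Z contains a colorful simplex, i.e., a simplex S ∈ Z with |S ∩ V_i| = 1 for all 1 ≤ i ≤ m. -/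
namespace SimplicialCpx

section FreeChains

variable {α : Type*} [LinearOrder α]

/-- The sign with which the facet `s.erase v` occurs in the boundary of `s`. -/
def facetSign (s : Finset α) (v : α) : ℚ := (-1) ^ (s.filter (· < v)).card

/-- The simplicial boundary on formal combinations of all finite subsets of `α`. -/
noncomputable def freeBdry (α : Type*) [LinearOrder α] :
    (Finset α →₀ ℚ) →ₗ[ℚ] (Finset α →₀ ℚ) :=
  Finsupp.linearCombination ℚ fun s =>
    ∑ v ∈ s, facetSign s v • Finsupp.single (s.erase v) (1 : ℚ)

theorem freeBdry_single (s : Finset α) :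
    freeBdry α (Finsupp.single s 1) =
      ∑ v ∈ s, facetSign s v • Finsupp.single (s.erase v) (1 : ℚ) := by
  simp [freeBdry]

theorem facetSign_mul_erase_of_lt {s : Finset α} {v w : α} (hv : v ∈ s) (h : v < w) :
    facetSign s v * facetSign (s.erase v) w = -(facetSign s w * facetSign (s.erase w) v) := by
  have hw : ((s.erase w).filter (· < v)) = s.filter (· < v) := by
    rw [Finset.filter_erase, Finset.erase_eq_of_notMem]
    simp [h.le]
  have hv' : ((s.erase v).filter (· < w)).card + 1 = (s.filter (· < w)).card := by
    rw [Finset.filter_erase]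
    exact Finset.card_erase_add_one (by simp [hv, h])
  simp only [facetSign, hw, ← hv', pow_succ]
  ring

theorem facetSign_mul_erase {s : Finset α} {v w : α} (hv : v ∈ s) (hw : w ∈ s) (h : v ≠ w) :
    facetSign s v * facetSign (s.erase v) w = -(facetSign s w * facetSign (s.erase w) v) := by
  rcases h.lt_or_gt with h | h
  · exact facetSign_mul_erase_of_lt hv h
  · rw [facetSign_mul_erase_of_lt hw h, neg_neg]

theorem freeBdry_freeBdry (x : Finset α →₀ ℚ) : freeBdry α (freeBdry α x) = 0 := by
  suffices h : freeBdry α ∘ₗ freeBdry α = 0 from LinearMap.congr_fun h x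
  refine Finsupp.lhom_ext' fun s => LinearMap.ext_ring ?_
  simp only [LinearMap.comp_apply, Finsupp.lsingle_apply, freeBdry_single, map_sum, map_smul,
    Finset.smul_sum, smul_smul, LinearMap.zero_apply]
  rw [Finset.sum_sigma']
  refine Finset.sum_involution (fun p _ => ⟨p.2, p.1⟩) ?_ ?_ ?_ ?_
  · rintro ⟨v, w⟩ h
    simp only [Finset.mem_sigma, Finset.mem_erase] at h
    rw [facetSign_mul_erase h.1 h.2.2 h.2.1.symm, Finset.erase_right_comm, ← add_smul]
    simp
  · rintro ⟨v, w⟩ h _ heq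
    simp only [Finset.mem_sigma, Finset.mem_erase] at h
    exact h.2.1 (congrArg Sigma.fst heq)
  · rintro ⟨v, w⟩ h
    simp only [Finset.mem_sigma, Finset.mem_erase] at h ⊢
    exact ⟨h.2.2, h.2.1.symm, h.1⟩
  · rintro ⟨v, w⟩ _
    rfl

theorem freeBdry_single_insert {a : α} {s : Finset α} (ha : ∀ x ∈ s, a < x) :
    freeBdry α (Finsupp.single (insert a s) 1) = Finsupp.single s 1 -
      ∑ v ∈ s, facetSign s v • Finsupp.single (insert a (s.erase v)) (1 : ℚ) := by
  have has : a ∉ s := fun h => lt_irrefl _ (ha a h)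
  have hsa : facetSign (insert a s) a = 1 := by
    rw [facetSign, Finset.filter_eq_empty_iff.2, Finset.card_empty, pow_zero]
    intro x hx
    rcases Finset.mem_insert.1 hx with rfl | hx
    · exact lt_irrefl _
    · exact (ha x hx).not_gt
  rw [freeBdry_single, Finset.sum_insert has, hsa, Finset.erase_insert has, one_smul,
    sub_eq_add_neg, ← Finset.sum_neg_distrib]
  congr 1
  refine Finset.sum_congr rfl fun v hv => ?_
  rw [Finset.erase_insert_of_ne (ha v hv).ne, ← neg_smul, facetSign, facetSign,
    Finset.filter_insert, if_pos (ha v hv), Finset.card_insert_of_notMem (by simp [has]), pow_succ]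
  simp

end FreeChains

section ExteriorMonomials

open ExteriorAlgebra CliffordAlgebra

variable {α M : Type*} [LinearOrder α] [AddCommGroup M] [Module ℚ M]

theorem prod_map_ι_eq_zero_of_not_nodup {l : List M} (h : ¬ l.Nodup) :
    (l.map (ExteriorAlgebra.ι ℚ)).prod = 0 := by
  have h1 : ¬ Function.Injective l.get := by rwa [← List.nodup_iff_injective_get]
  have h2 := (ιMulti ℚ l.length).map_eq_zero_of_not_injective l.get h1
  rw [ιMulti_apply] at h2
  rw [← h2]
  congr 1
  conv_lhs => rw [← List.ofFn_get l, List.map_ofFn]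
  rfl

theorem contractLeft_prod_map_ι_eq_zero (d : Module.Dual ℚ M) {l : List M}
    (h : ∀ x ∈ l, d x = 0) :
    contractLeft (Q := (0 : QuadraticForm ℚ M)) d (l.map (ExteriorAlgebra.ι ℚ)).prod = 0 := by
  induction l with
  | nil => exact contractLeft_one 0 d
  | cons x l ih =>
    rw [List.map_cons, List.prod_cons]
    refine (contractLeft_ι_mul (Q := (0 : QuadraticForm ℚ M)) d x _).trans ?_
    rw [h x (by simp), ih fun y hy => h y (by simp [hy])]
    simp

/-- The linear map sending a finite set `{v₁ < ⋯ < vₖ}` to `p v₁ ∧ ⋯ ∧ p vₖ`. -/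
noncomputable def wedge (p : α → M) : (Finset α →₀ ℚ) →ₗ[ℚ] ExteriorAlgebra ℚ M :=
  Finsupp.linearCombination ℚ fun s => ((s.sort.map p).map (ExteriorAlgebra.ι ℚ)).prod

theorem wedge_single (p : α → M) (s : Finset α) :
    wedge p (Finsupp.single s 1) = ((s.sort.map p).map (ExteriorAlgebra.ι ℚ)).prod := by
  simp [wedge]

theorem wedge_single_empty (p : α → M) : wedge p (Finsupp.single ∅ 1) = 1 := by
  simp [wedge_single]

theorem wedge_single_insert (p : α → M) {a : α} {s : Finset α} (ha : ∀ x ∈ s, a < x) :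
    wedge p (Finsupp.single (insert a s) 1) =
      ExteriorAlgebra.ι ℚ (p a) * wedge p (Finsupp.single s 1) := by
  rw [wedge_single, wedge_single, Finset.sort_insert (· ≤ ·) (fun b hb => (ha b hb).le)
    fun h => lt_irrefl _ (ha a h)]
  simp

theorem contractLeft_wedge (p : α → M) (d : Module.Dual ℚ M) (hd : ∀ v, d (p v) = 1)
    (x : Finset α →₀ ℚ) :
    contractLeft (Q := (0 : QuadraticForm ℚ M)) d (wedge p x) = wedge p (freeBdry α x) := by
  suffices h : (contractLeft (Q := (0 : QuadraticForm ℚ M)) d) ∘ₗ wedge p =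
      wedge p ∘ₗ freeBdry α from LinearMap.congr_fun h x
  refine Finsupp.lhom_ext' fun s => LinearMap.ext_ring ?_
  simp only [LinearMap.comp_apply, Finsupp.lsingle_apply]
  induction s using Finset.induction_on_min with
  | empty =>
    rw [wedge_single_empty, freeBdry_single, Finset.sum_empty, map_zero]
    exact contractLeft_one 0 d
  | insert a s ha ih =>
    rw [wedge_single_insert p ha, freeBdry_single_insert ha]
    refine (contractLeft_ι_mul (Q := (0 : QuadraticForm ℚ M)) d (p a) _).trans ?_
    rw [ih, hd, one_smul, map_sub, freeBdry_single, map_sum, map_sum, Finset.mul_sum]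
    congr 1
    refine Finset.sum_congr rfl fun v _ => ?_
    rw [map_smul, map_smul, wedge_single_insert p fun x hx => ha x (Finset.mem_of_mem_erase hx)]
    exact mul_smul_comm _ _ _

theorem eq_zero_of_ι_mul_eq_zero_of_contractLeft_eq_zero (d : Module.Dual ℚ M) {y : M}
    (hy : d y = 1) {x : ExteriorAlgebra ℚ M} (hyx : ExteriorAlgebra.ι ℚ y * x = 0)
    (hdx : contractLeft (Q := (0 : QuadraticForm ℚ M)) d x = 0) : x = 0 := by
  have h := contractLeft_ι_mul (Q := (0 : QuadraticForm ℚ M)) (d := d) y x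
  rw [hdx, hy, one_smul, mul_zero, sub_zero] at h
  rw [← h]
  exact (congrArg _ hyx).trans (map_zero _)

theorem wedge_single_ne_zero {p : α → M} (δ : α → Module.Dual ℚ M) (hδ : ∀ i, δ i (p i) = 1)
    (hδ' : ∀ i j, i ≠ j → δ i (p j) = 0) (s : Finset α) :
    wedge p (Finsupp.single s 1) ≠ 0 := by
  induction s using Finset.induction_on_min with
  | empty => rw [wedge_single_empty]; exact one_ne_zero
  | insert a s ha ih =>
    intro h
    rw [wedge_single_insert p ha] at h
    refine ih (eq_zero_of_ι_mul_eq_zero_of_contractLeft_eq_zero (δ a) (hδ a) h ?_)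
    rw [wedge_single]
    refine contractLeft_prod_map_ι_eq_zero _ fun x hx => ?_
    obtain ⟨j, hj, rfl⟩ := List.mem_map.1 hx
    exact hδ' a j (ha j (by simpa using hj)).ne

theorem ι_mul_wedge_single_eq_zero {β : Type*} [DecidableEq β] (c : α → β) (p : β → M)
    {s : Finset α} {I : Finset β}
    (hs : ∀ v ∈ s, c v ∈ I) (hcard : s.card = I.card) {i : β} (hi : i ∈ I) :
    ExteriorAlgebra.ι ℚ (p i) * wedge (p ∘ c) (Finsupp.single s 1) = 0 := by
  rw [wedge_single, ← List.prod_cons, ← List.map_cons]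
  apply prod_map_ι_eq_zero_of_not_nodup
  rw [← List.map_map, ← List.map_cons]
  intro h
  have h := h.of_map
  have hsub : (i :: s.sort.map c).toFinset ⊆ I := by
    intro j hj
    simp only [List.mem_toFinset, List.mem_cons, List.mem_map, Finset.mem_sort] at hj
    rcases hj with rfl | ⟨v, hv, rfl⟩
    · exact hi
    · exact hs v hv
  have := Finset.card_le_card hsub
  rw [List.toFinset_card_of_nodup h] at this
  simp at this
  omega

theorem wedge_single_eq_zero_of_not_injOn {β : Type*} (c : α → β) (p : β → M) {s : Finset α}
    (h : ¬ Set.InjOn c s) : wedge (p ∘ c) (Finsupp.single s 1) = 0 := by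
  rw [wedge_single]
  apply prod_map_ι_eq_zero_of_not_nodup
  rw [← List.map_map]
  intro hnd
  refine h fun v hv w hw hvw => ?_
  exact List.inj_on_of_nodup_map hnd.of_map (by simpa using hv) (by simpa using hw) hvw

theorem wedge_mem_of_supported {p : α → M} {N : Submodule ℚ (ExteriorAlgebra ℚ M)}
    {S : Set (Finset α)} (h : ∀ s ∈ S, wedge p (Finsupp.single s 1) ∈ N)
    {x : Finset α →₀ ℚ} (hx : x ∈ Finsupp.supported ℚ ℚ S) : wedge p x ∈ N := by
  have : Finsupp.supported ℚ ℚ S ≤ N.comap (wedge p) := by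
    rw [Finsupp.supported_eq_span_single, Submodule.span_le]
    rintro _ ⟨s, hs, rfl⟩
    exact h s hs
  exact this hx

end ExteriorMonomials

section Homology

variable {V : Type*}

/-- Chains of `X` viewed as formal combinations of arbitrary finite sets. -/
noncomputable def toFree (X : SimplicialCpx V) (n : ℕ) : X.Chain n →ₗ[ℚ] (Finset V →₀ ℚ) :=
  Finsupp.lmapDomain ℚ ℚ Subtype.val

theorem toFree_injective (X : SimplicialCpx V) (n : ℕ) : Function.Injective (X.toFree n) :=
  Finsupp.mapDomain_injective Subtype.val_injective

theorem range_toFree (X : SimplicialCpx V) (n : ℕ) :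
    LinearMap.range (X.toFree n) =
      Finsupp.supported ℚ ℚ {s : Finset V | s ∈ X.faces ∧ s.card = n} := by
  have h := Finsupp.lmapDomain_supported ℚ ℚ
    (Subtype.val : {s : Finset V // s ∈ X.faces ∧ s.card = n} → Finset V) Set.univ
  rw [Finsupp.supported_univ, Submodule.map_top, Set.image_univ] at h
  exact h.trans (congrArg _ Subtype.range_coe)

variable [LinearOrder V]

theorem freeBdry_toFree (X : SimplicialCpx V) (n : ℕ) (x : X.Chain (n + 1)) :
    freeBdry V (X.toFree (n + 1) x) = X.toFree n (X.bdry n x) := by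
  suffices h : freeBdry V ∘ₗ X.toFree (n + 1) = X.toFree n ∘ₗ X.bdry n from
    LinearMap.congr_fun h x
  refine Finsupp.lhom_ext' fun s => LinearMap.ext_ring ?_
  simp only [LinearMap.comp_apply, Finsupp.lsingle_apply, toFree, bdry,
    Finsupp.lmapDomain_apply, Finsupp.mapDomain_single, freeBdry_single, Finsupp.lsum_single,
    LinearMap.toSpanSingleton_apply, one_smul, facetSign]
  rw [← Finset.sum_attach, Finsupp.mapDomain_finsetSum]
  simp [Finsupp.mapDomain_single]

theorem mem_cycles_of_freeBdry_eq_zero (X : SimplicialCpx V) {n : ℕ} {x : X.Chain n}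
    (h : freeBdry V (X.toFree n x) = 0) : x ∈ X.cycles n := by
  cases n with
  | zero => exact Submodule.mem_top
  | succ n =>
    rw [freeBdry_toFree] at h
    exact X.toFree_injective n (h.trans (map_zero _).symm)

theorem subsingleton_redH_of_lt_eta {X : SimplicialCpx V} {n : ℕ} (h : (n : ℕ∞) < X.eta) :
    Subsingleton (X.redH n) := by
  rw [← not_nontrivial_iff_subsingleton]
  exact fun hn => h.not_ge (sInf_le ⟨n, rfl, hn⟩)

theorem exists_freeBdry_eq {X : SimplicialCpx V} {n : ℕ} (h : (n : ℕ∞) < X.eta)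
    {z : Finset V →₀ ℚ}
    (hz : z ∈ Finsupp.supported ℚ ℚ {s : Finset V | s ∈ X.faces ∧ s.card = n})
    (hdz : freeBdry V z = 0) :
    ∃ y ∈ Finsupp.supported ℚ ℚ {s : Finset V | s ∈ X.faces ∧ s.card = n + 1},
      freeBdry V y = z := by
  rw [← range_toFree] at hz
  obtain ⟨x, rfl⟩ := hz
  have hs := subsingleton_redH_of_lt_eta h
  unfold redH at hs
  rw [Submodule.Quotient.subsingleton_iff] at hs
  have hx : (⟨x, X.mem_cycles_of_freeBdry_eq_zero hdz⟩ : X.cycles n) ∈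
      Submodule.comap (X.cycles n).subtype (LinearMap.range (X.bdry n)) := hs ▸ Submodule.mem_top
  obtain ⟨y, hy⟩ := hx
  refine ⟨X.toFree (n + 1) y, ?_, ?_⟩
  · rw [← range_toFree]
    exact LinearMap.mem_range_self _ _
  · rw [freeBdry_toFree, hy]
    rfl

end Homology

section Colorful

variable {V β : Type*} [LinearOrder V] [LinearOrder β]

/-- The faces of `Z` of size `|I|` whose colors under `c` all lie in `I`. -/
def coloredFaces (Z : SimplicialCpx V) (c : V → β) (I : Finset β) : Set (Finset V) :=
  {s | (s ∈ Z.faces ∧ (s : Set V) ⊆ c ⁻¹' I) ∧ s.card = I.card}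

/-- An acyclic-carrier argument: chains `F I` on the faces colored by `I` that are compatible with
the boundary of the full simplex on the set of colors, up to dimension `n`. -/
theorem exists_chain_map_le (Z : SimplicialCpx V) (c : V → β)
    (heta : ∀ I : Finset β, I.Nonempty → (I.card : ℕ∞) ≤ (Z.induce (c ⁻¹' I)).eta) (n : ℕ) :
    ∃ F : Finset β → (Finset V →₀ ℚ), F ∅ = Finsupp.single ∅ 1 ∧
      ∀ I : Finset β, I.card ≤ n → F I ∈ Finsupp.supported ℚ ℚ (Z.coloredFaces c I) ∧
        freeBdry V (F I) = Finsupp.linearCombination ℚ F (freeBdry β (Finsupp.single I 1)) := by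
  induction n with
  | zero =>
    refine ⟨fun _ => Finsupp.single ∅ 1, rfl, fun I hI => ?_⟩
    obtain rfl : I = ∅ := by simpa using hI
    refine ⟨Finsupp.single_mem_supported ℚ _ ⟨⟨Z.empty_mem, by simp⟩, rfl⟩, ?_⟩
    simp [freeBdry_single]
  | succ n ih =>
    obtain ⟨F, hF0, hF⟩ := ih
    have key : ∀ I : Finset β, I.card = n + 1 →
        ∃ y ∈ Finsupp.supported ℚ ℚ (Z.coloredFaces c I), freeBdry V y =
          Finsupp.linearCombination ℚ F (freeBdry β (Finsupp.single I 1)) := by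
      intro I hI
      have hcomm : ∀ x ∈ Finsupp.supported ℚ ℚ {J : Finset β | J.card ≤ n},
          freeBdry V (Finsupp.linearCombination ℚ F x) =
            Finsupp.linearCombination ℚ F (freeBdry β x) := by
        intro x hx
        rw [Finsupp.supported_eq_span_single] at hx
        refine LinearMap.eqOn_span (f := freeBdry V ∘ₗ Finsupp.linearCombination ℚ F)
          (g := Finsupp.linearCombination ℚ F ∘ₗ freeBdry β) ?_ hx
        rintro _ ⟨J, hJ, rfl⟩
        simpa using (hF J hJ).2
      have hne : I.Nonempty := Finset.card_pos.1 (by omega)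
      have hlt : (n : ℕ∞) < (Z.induce (c ⁻¹' I)).eta := by
        refine lt_of_lt_of_le ?_ (heta I hne)
        rw [hI]
        exact_mod_cast n.lt_succ_self
      have hcard : ∀ v ∈ I, (I.erase v).card = n := fun v hv => by
        rw [Finset.card_erase_of_mem hv, hI]; rfl
      obtain ⟨y, hy, hdy⟩ := exists_freeBdry_eq hlt
        (z := Finsupp.linearCombination ℚ F (freeBdry β (Finsupp.single I 1))) (by
          rw [freeBdry_single, map_sum]
          refine Submodule.sum_mem _ fun v hv => ?_
          rw [map_smul, Finsupp.linearCombination_single, one_smul]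
          refine Submodule.smul_mem _ _ (Finsupp.supported_mono ?_ (hF _ (hcard v hv).le).1)
          rintro s ⟨⟨h1, h2⟩, h3⟩
          exact ⟨⟨h1, h2.trans (Set.preimage_mono (by simp))⟩, h3.trans (hcard v hv)⟩) (by
          rw [hcomm, freeBdry_freeBdry, map_zero]
          rw [freeBdry_single]
          refine Submodule.sum_mem _ fun v hv => Submodule.smul_mem _ _ ?_
          exact Finsupp.single_mem_supported ℚ _ (hcard v hv).le)
      refine ⟨y, Finsupp.supported_mono ?_ hy, hdy⟩
      rintro s ⟨hs, h3⟩
      exact ⟨hs, h3.trans hI.symm⟩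
    choose! G hG using key
    let F' : Finset β → (Finset V →₀ ℚ) := fun I => if I.card = n + 1 then G I else F I
    have hF' : ∀ I : Finset β, I.card ≤ n → F' I = F I := fun I hI => if_neg (by omega)
    have hlin : ∀ I : Finset β, I.card ≤ n + 1 →
        Finsupp.linearCombination ℚ F' (freeBdry β (Finsupp.single I 1)) =
          Finsupp.linearCombination ℚ F (freeBdry β (Finsupp.single I 1)) := by
      intro I hI
      simp only [freeBdry_single, map_sum, map_smul, Finsupp.linearCombination_single]
      refine Finset.sum_congr rfl fun v hv => ?_
      rw [hF' _ (by rw [Finset.card_erase_of_mem hv]; omega)]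
    refine ⟨F', (hF' ∅ (by simp)).trans hF0, fun I hI => ?_⟩
    rw [hlin I hI]
    by_cases h : I.card = n + 1
    · rw [show F' I = G I from if_pos h]
      exact hG I h
    · rw [hF' I (by omega)]
      exact hF I (by omega)

theorem exists_face_injOn [Fintype β] (Z : SimplicialCpx V) (c : V → β)
    (heta : ∀ I : Finset β, I.Nonempty → (I.card : ℕ∞) ≤ (Z.induce (c ⁻¹' I)).eta) :
    ∃ s ∈ Z.faces, Set.InjOn c s ∧ s.card = Fintype.card β := by
  obtain ⟨F, hF0, hF⟩ := Z.exists_chain_map_le c heta (Fintype.card β)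
  replace hF := fun I : Finset β => hF I I.card_le_univ
  let p : β → β →₀ ℚ := fun i => Finsupp.single i 1
  let d : Module.Dual ℚ (β →₀ ℚ) := Finsupp.linearCombination ℚ fun _ => 1
  have hd : ∀ i, d (p i) = 1 := fun i => by simp [d, p]
  have hwedge : ∀ I : Finset β, wedge (p ∘ c) (F I) = wedge p (Finsupp.single I 1) := by
    intro I
    induction hn : I.card generalizing I with
    | zero =>
      obtain rfl := Finset.card_eq_zero.1 hn
      rw [hF0, wedge_single_empty, wedge_single_empty]
    | succ n ih =>
      obtain ⟨i, hi⟩ : I.Nonempty := Finset.card_pos.1 (by omega)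
      rw [← sub_eq_zero]
      refine eq_zero_of_ι_mul_eq_zero_of_contractLeft_eq_zero d (hd i) ?_ ?_
      · rw [mul_sub, sub_eq_zero]
        have h1 : ExteriorAlgebra.ι ℚ (p i) * wedge (p ∘ c) (F I) = 0 :=
          wedge_mem_of_supported
            (N := LinearMap.ker (LinearMap.mulLeft ℚ (ExteriorAlgebra.ι ℚ (p i))))
            (fun s hs => ι_mul_wedge_single_eq_zero c p (fun v hv => hs.1.2 hv) hs.2 hi) (hF I).1
        rw [h1]
        exact (ι_mul_wedge_single_eq_zero id p (fun _ h => h) rfl hi).symm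
      · rw [map_sub, contractLeft_wedge (p ∘ c) d fun v => hd (c v), contractLeft_wedge p d hd,
          (hF I).2, sub_eq_zero, freeBdry_single]
        simp only [map_sum, map_smul, Finsupp.linearCombination_single, one_smul]
        refine Finset.sum_congr rfl fun v hv => ?_
        rw [ih _ (by rw [Finset.card_erase_of_mem hv, hn]; rfl)]
  by_contra! hno
  have hne : wedge p (Finsupp.single Finset.univ 1) ≠ 0 :=
    wedge_single_ne_zero (fun i => Finsupp.lapply i) (fun i => by simp [p])
      (fun i j hij => by simp [p, hij.symm]) _
  refine hne ?_
  rw [← hwedge, ← Submodule.mem_bot ℚ]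
  refine wedge_mem_of_supported (fun s hs => ?_) (hF Finset.univ).1
  exact wedge_single_eq_zero_of_not_injOn c p fun hinj => hno s hs.1.1 hinj hs.2

end Colorful

end SimplicialCpx


/-- **Meshulam's lemma.** Let `Z` be a simplicial complex on a finite vertex set `V`
partitioned into colour classes `V₁, …, V_m`.  If `η(Z[⋃_{i ∈ I} Vᵢ]) ≥ |I|` for every
non-empty `I ⊆ [m]`, then `Z` contains a colorful simplex, i.e. a face meeting each
`Vᵢ` in exactly one vertex. -/
theorem meshulam_lemma {V : Type*} [LinearOrder V] [Fintype V]
    (Z : SimplicialCpx V) (m : ℕ) (P : Fin m → Finset V)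
    (hdisj : ∀ i j, i ≠ j → Disjoint (P i) (P j))
    (hcover : Finset.univ.biUnion P = Finset.univ)
    (heta : ∀ I : Finset (Fin m), I.Nonempty →
      (I.card : ℕ∞) ≤ (Z.induce ↑(I.biUnion P)).eta) :
    ∃ S ∈ Z.faces, ∀ i, (S ∩ P i).card = 1 := by
  classical
  have hmem : ∀ v, ∃ i, v ∈ P i := fun v => by
    have := hcover ▸ Finset.mem_univ v
    simpa using this
  choose c hc using hmem
  have hcP : ∀ v i, v ∈ P i ↔ c v = i := by
    refine fun v i => ⟨fun hv => ?_, fun h => h ▸ hc v⟩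
    by_contra hne
    exact Finset.disjoint_left.1 (hdisj _ _ hne) (hc v) hv
  obtain ⟨S, hS, hinj, hcard⟩ := Z.exists_face_injOn c fun I hI => by
    convert heta I hI
    ext v
    simp [hcP]
  have himg : S.image c = Finset.univ := by
    rw [← Finset.card_eq_iff_eq_univ, Finset.card_image_of_injOn hinj, hcard]
  refine ⟨S, hS, fun i => ?_⟩
  obtain ⟨v, hv, rfl⟩ := Finset.mem_image.1 (himg ▸ Finset.mem_univ i)
  rw [Finset.card_eq_one]
  refine ⟨v, Finset.ext fun w => ?_⟩
  simp only [Finset.mem_inter, Finset.mem_singleton, hcP]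
  constructor
  · rintro ⟨hw, h⟩
    exact hinj hw hv h
  · rintro rfl
    exact ⟨hv, rfl⟩
end

section
/- Let M be a loopless oriented matroid of rank r on finite ground set V, and let X be its support complex (subsets of V containing no positive circuit). Then H̃_j(X; ℚ) = 0 for all j ≥ r. -/
/-- A signed subset of `V`: a pair of disjoint finite sets of positive and
negative elements. -/
structure SignedSet (V : Type*) [DecidableEq V] where
  pos : Finset V
  neg : Finset V
  disj : Disjoint pos neg

namespace SignedSet

variable {V : Type*} [DecidableEq V]

/-- The support of a signed set. -/
def support (C : SignedSet V) : Finset V := C.pos ∪ C.neg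

/-- The negation of a signed set. -/
def negate (C : SignedSet V) : SignedSet V := ⟨C.neg, C.pos, C.disj.symm⟩

end SignedSet

/-- An oriented matroid on `V`, given by its signed circuit axioms. -/
structure OrientedMatroid (V : Type*) [DecidableEq V] where
  Circuits : Set (SignedSet V)
  support_nonempty : ∀ C ∈ Circuits, C.support.Nonempty
  negate_mem : ∀ C ∈ Circuits, C.negate ∈ Circuits
  incomparable : ∀ C ∈ Circuits, ∀ D ∈ Circuits,
    C.support ⊆ D.support → C = D ∨ C = D.negate
  elimination : ∀ C ∈ Circuits, ∀ D ∈ Circuits, C ≠ D.negate →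
    ∀ e ∈ C.pos ∩ D.neg, ∃ Z ∈ Circuits,
      Z.pos ⊆ (C.pos ∪ D.pos).erase e ∧ Z.neg ⊆ (C.neg ∪ D.neg).erase e

namespace OrientedMatroid

variable {V : Type*} [DecidableEq V]

/-- A set is independent in (the underlying matroid of) an oriented matroid if it
contains no circuit support. -/
def Indep (M : OrientedMatroid V) (S : Finset V) : Prop :=
  ∀ C ∈ M.Circuits, ¬ C.support ⊆ S

/-- The rank of (the underlying matroid of) an oriented matroid: the maximal
cardinality of an independent set. -/
noncomputable def rank [Fintype V] (M : OrientedMatroid V) : ℕ :=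
  sSup {n | ∃ S : Finset V, M.Indep S ∧ S.card = n}

/-- An oriented matroid is loopless if it has no one-element circuits. -/
def Loopless (M : OrientedMatroid V) : Prop :=
  ∀ C ∈ M.Circuits, C.support.card ≠ 1

/-- `S` is a positive circuit of `M`: the set of positive elements of a circuit
with no negative elements. -/
def PosCircuit (M : OrientedMatroid V) (S : Finset V) : Prop :=
  ∃ C ∈ M.Circuits, C.neg = ∅ ∧ C.pos = S

/-- The support complex of an oriented matroid: faces are the sets containing no
positive circuit. -/
def suppComplex (M : OrientedMatroid V) : SimplicialCpx V where
  faces := {S | ∀ T ⊆ S, ¬ M.PosCircuit T}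
  down_closed := fun s hs t hts T hTt => hs T (hTt.trans hts)
  empty_mem := by
    intro T hT hPC
    obtain ⟨C, hC, hneg, hpos⟩ := hPC
    obtain ⟨x, hx⟩ := M.support_nonempty C hC
    rw [SignedSet.support, hneg, hpos] at hx
    have : T = ∅ := Finset.subset_empty.mp hT
    subst this
    simp at hx

end OrientedMatroid

namespace SimplicialCpx

variable {V : Type*}

/-- The chains with all faces in `K` and of cardinality `n`. -/
noncomputable def chainsIn (K : Set (Finset V)) (n : ℕ) : Submodule ℚ (Finset V →₀ ℚ) :=
  Finsupp.supported ℚ ℚ {s | s ∈ K ∧ s.card = n}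

theorem chainsIn_mono {K L : Set (Finset V)} (h : K ⊆ L) (n : ℕ) :
    chainsIn K n ≤ chainsIn L n :=
  Finsupp.supported_mono fun _ hs => ⟨h hs.1, hs.2⟩

theorem chainsIn_eq_span (K : Set (Finset V)) (n : ℕ) :
    chainsIn K n =
      Submodule.span ℚ ((fun s => Finsupp.single s (1 : ℚ)) '' {s | s ∈ K ∧ s.card = n}) :=
  Finsupp.supported_eq_span_single ℚ _

theorem single_mem_chainsIn {K : Set (Finset V)} {s : Finset V} (hs : s ∈ K) :
    Finsupp.single s (1 : ℚ) ∈ chainsIn K s.card :=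
  Finsupp.single_mem_supported ℚ _ ⟨hs, rfl⟩

/-- The inclusion of the chains of `X` into the chains on all finite subsets of `V`. -/
noncomputable def chainIncl (X : SimplicialCpx V) (n : ℕ) :
    X.Chain n →ₗ[ℚ] (Finset V →₀ ℚ) :=
  Finsupp.lmapDomain ℚ ℚ Subtype.val

theorem chainIncl_injective (X : SimplicialCpx V) (n : ℕ) :
    Function.Injective (X.chainIncl n) :=
  Finsupp.mapDomain_injective Subtype.val_injective

theorem range_chainIncl (X : SimplicialCpx V) (n : ℕ) :
    LinearMap.range (X.chainIncl n) = chainsIn X.faces n := by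
  rw [chainIncl, Finsupp.range_lmapDomain, chainsIn_eq_span]
  congr 1
  ext c
  simp

variable [LinearOrder V]

/-- The simplicial boundary map on formal combinations of all finite subsets of `V`. -/
noncomputable def bdryAll (V : Type*) [LinearOrder V] :
    (Finset V →₀ ℚ) →ₗ[ℚ] (Finset V →₀ ℚ) :=
  Finsupp.lsum ℚ fun s => LinearMap.toSpanSingleton ℚ (Finset V →₀ ℚ)
    (∑ v ∈ s, ((-1 : ℚ) ^ (s.filter (· < v)).card) • Finsupp.single (s.erase v) (1 : ℚ))

theorem bdryAll_single (s : Finset V) :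
    bdryAll V (Finsupp.single s 1) =
      ∑ v ∈ s, ((-1 : ℚ) ^ (s.filter (· < v)).card) • Finsupp.single (s.erase v) (1 : ℚ) := by
  simp [bdryAll]

theorem bdryAll_mem_chainsIn {K : Set (Finset V)} (hK : ∀ s ∈ K, ∀ t ⊆ s, t ∈ K) {n : ℕ}
    {c : Finset V →₀ ℚ} (hc : c ∈ chainsIn K (n + 1)) : bdryAll V c ∈ chainsIn K n := by
  rw [chainsIn_eq_span] at hc
  induction hc using Submodule.span_induction with
  | mem x hx =>
    obtain ⟨s, ⟨hs, hcard⟩, rfl⟩ := hx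
    rw [bdryAll_single]
    refine Submodule.sum_mem _ fun v hv => Submodule.smul_mem _ _ ?_
    have h := single_mem_chainsIn (hK s hs _ (Finset.erase_subset v s))
    rwa [Finset.card_erase_of_mem hv, hcard, Nat.add_sub_cancel] at h
  | zero => simp
  | add x y _ _ hx hy => rw [map_add]; exact add_mem hx hy
  | smul a x _ hx => rw [map_smul]; exact Submodule.smul_mem _ _ hx

/-- The cone over a chain with apex `v`. -/
noncomputable def cone (v : V) : (Finset V →₀ ℚ) →ₗ[ℚ] (Finset V →₀ ℚ) :=
  Finsupp.lmapDomain ℚ ℚ (insert v)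

theorem cone_single (v : V) (s : Finset V) :
    cone v (Finsupp.single s 1) = Finsupp.single (insert v s) 1 := by
  simp [cone]

theorem bdryAll_cone_single {v : V} {s : Finset V} (hv : ∀ u ∈ s, v < u) :
    bdryAll V (cone v (Finsupp.single s 1)) =
      Finsupp.single s 1 - cone v (bdryAll V (Finsupp.single s 1)) := by
  have hvs : v ∉ s := fun h => lt_irrefl _ (hv v h)
  rw [cone_single, bdryAll_single, bdryAll_single, Finset.sum_insert hvs, map_sum,
    sub_eq_add_neg, ← Finset.sum_neg_distrib]
  congr 1
  · have : (insert v s).filter (· < v) = ∅ := by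
      ext u
      simp only [Finset.mem_filter, Finset.mem_insert, Finset.notMem_empty, iff_false]
      rintro ⟨rfl | hu, h⟩
      · exact lt_irrefl _ h
      · exact lt_asymm h (hv u hu)
    rw [this, Finset.erase_insert hvs]
    simp
  · refine Finset.sum_congr rfl fun u hu => ?_
    rw [map_smul, cone_single, Finset.filter_insert, if_pos (hv u hu),
      Finset.card_insert_of_notMem (by simp [hvs]), pow_succ, mul_neg_one, neg_smul,
      Finset.erase_insert_of_ne (hv u hu).ne]

theorem bdryAll_cone {K : Set (Finset V)} {v : V} (hv : ∀ s ∈ K, ∀ u ∈ s, v < u) {n : ℕ}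
    {c : Finset V →₀ ℚ} (hc : c ∈ chainsIn K n) :
    bdryAll V (cone v c) = c - cone v (bdryAll V c) := by
  rw [chainsIn_eq_span] at hc
  induction hc using Submodule.span_induction with
  | mem x hx =>
    obtain ⟨s, ⟨hs, -⟩, rfl⟩ := hx
    exact bdryAll_cone_single (hv s hs)
  | zero => simp
  | add x y _ _ hx hy => simp only [map_add, hx, hy]; abel
  | smul a x _ hx => simp only [map_smul, hx, smul_sub]

theorem bdryAll_bdryAll_single (s : Finset V) :
    bdryAll V (bdryAll V (Finsupp.single s 1)) = 0 := by
  induction s using Finset.induction_on_min with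
  | empty => simp [bdryAll_single]
  | insert v s hv ih =>
    have hmem : bdryAll V (Finsupp.single s 1) ∈ chainsIn {t | t ⊆ s} (s.card - 1) := by
      rcases s.eq_empty_or_nonempty with rfl | hs
      · simp [bdryAll_single]
      · refine bdryAll_mem_chainsIn (fun t ht u hu => hu.trans ht) ?_
        rw [Nat.sub_add_cancel hs.card_pos]
        exact single_mem_chainsIn (K := {t | t ⊆ s}) (Finset.Subset.refl s)
    rw [← cone_single, bdryAll_cone_single hv, map_sub,
      bdryAll_cone (K := {t | t ⊆ s}) (fun t ht u hu => hv u (ht hu)) hmem, ih]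
    simp

theorem bdryAll_bdryAll (c : Finset V →₀ ℚ) : bdryAll V (bdryAll V c) = 0 := by
  have h : bdryAll V ∘ₗ bdryAll V = 0 := by
    refine Finsupp.lhom_ext' fun s => LinearMap.ext_ring ?_
    simpa using bdryAll_bdryAll_single s
  exact LinearMap.congr_fun h c

/-- Vanishing of the homology of the family of faces `K` on faces of cardinality `n`. -/
def ExactAt (K : Set (Finset V)) (n : ℕ) : Prop :=
  ∀ c ∈ chainsIn K n, bdryAll V c = 0 → ∃ d ∈ chainsIn K (n + 1), bdryAll V d = c

/-- If the deletion `D` of `v` in `K` is the union of the link `A` of `v` with some family `B`,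
then exactness of `K` follows from that of `D` and, one dimension lower, of `A ∩ B`. -/
theorem ExactAt.of_link_union {K D A B : Set (Finset V)} {v : V} {n : ℕ}
    (hD : D = {s ∈ K | v ∉ s}) (hA : A = {s | v ∉ s ∧ insert v s ∈ K})
    (hK : ∀ s ∈ K, ∀ t ⊆ s, t ∈ K) (hB : ∀ s ∈ B, ∀ t ⊆ s, t ∈ B)
    (hv : ∀ s ∈ D, ∀ u ∈ s, v < u) (hDAB : D ⊆ A ∪ B)
    (hexD : ExactAt D (n + 1)) (hexAB : ExactAt (A ∩ B) n) : ExactAt K (n + 1) := by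
  have hDK : D ⊆ K := by rw [hD]; exact fun s hs => hs.1
  have hDv : ∀ s ∈ D, v ∉ s := by rw [hD]; exact fun s hs => hs.2
  have hAv : ∀ s ∈ A, v ∉ s := by rw [hA]; exact fun s hs => hs.1
  have hAK : ∀ s ∈ A, insert v s ∈ K := by rw [hA]; exact fun s hs => hs.2
  have hAD : A ⊆ D := by
    rw [hD]
    exact fun s hs => ⟨hK _ (hAK s hs) _ (Finset.subset_insert v s), hAv s hs⟩
  have hDd : ∀ s ∈ D, ∀ t ⊆ s, t ∈ D := by
    rw [hD]
    exact fun s hs t ht => ⟨hK s hs.1 t ht, fun h => hs.2 (ht h)⟩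
  have hAd : ∀ s ∈ A, ∀ t ⊆ s, t ∈ A := by
    rw [hA]
    exact fun s hs t ht => ⟨fun h => hs.1 (ht h), hK _ hs.2 _ (Finset.insert_subset_insert v ht)⟩
  have hconeA : ∀ {m c}, c ∈ chainsIn A m → cone v c ∈ chainsIn K (m + 1) := by
    intro m c hc
    have h : cone v c ∈ (chainsIn A m).map (cone v) := Submodule.mem_map_of_mem hc
    rw [chainsIn, cone, Finsupp.lmapDomain_supported] at h
    refine Finsupp.supported_mono ?_ h
    rintro _ ⟨s, ⟨hs, hcard⟩, rfl⟩
    exact ⟨hAK s hs, by rw [Finset.card_insert_of_notMem (hAv s hs), hcard]⟩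
  intro z hz hz0
  obtain ⟨a, ha, b, hb, rfl⟩ : ∃ a ∈ chainsIn D (n + 1), ∃ b ∈ chainsIn A n, a + cone v b = z := by
    have hle : chainsIn K (n + 1) ≤ chainsIn D (n + 1) ⊔ (chainsIn A n).map (cone v) := by
      rw [chainsIn, chainsIn, chainsIn, cone, Finsupp.lmapDomain_supported,
        ← Finsupp.supported_union]
      refine Finsupp.supported_mono ?_
      rintro s ⟨hs, hcard⟩
      by_cases hvs : v ∈ s
      · refine Or.inr ⟨s.erase v, ⟨?_, ?_⟩, Finset.insert_erase hvs⟩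
        · rw [hA]
          exact ⟨Finset.notMem_erase v s, by rwa [Finset.insert_erase hvs]⟩
        · rw [Finset.card_erase_of_mem hvs, hcard, Nat.add_sub_cancel]
      · exact Or.inl ⟨by rw [hD]; exact ⟨hs, hvs⟩, hcard⟩
    obtain ⟨a, ha, _, ⟨b, hb, rfl⟩, hab⟩ := Submodule.mem_sup.1 (hle hz)
    exact ⟨a, ha, b, hb, hab⟩
  have hab : bdryAll V a = -b := by
    rw [map_add, bdryAll_cone (fun s hs => hv s (hAD hs)) hb] at hz0
    have heq : bdryAll V a + b = cone v (bdryAll V b) := by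
      rw [← sub_eq_zero, ← hz0]; abel
    have h1 : bdryAll V a + b ∈ Finsupp.supported ℚ ℚ {s : Finset V | v ∉ s} :=
      Finsupp.supported_mono (fun s hs => hDv s hs.1)
        (add_mem (bdryAll_mem_chainsIn hDd ha) (chainsIn_mono hAD n hb))
    have h2 : cone v (bdryAll V b) ∈ Finsupp.supported ℚ ℚ {s : Finset V | v ∈ s} := by
      have h : cone v (bdryAll V b) ∈ (Finsupp.supported ℚ ℚ Set.univ).map (cone v) :=
        Submodule.mem_map_of_mem (by simp [Finsupp.supported_univ])
      rw [cone, Finsupp.lmapDomain_supported] at h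
      refine Finsupp.supported_mono ?_ h
      rintro _ ⟨s, -, rfl⟩
      exact Finset.mem_insert_self v s
    have hdisj : Disjoint {s : Finset V | v ∉ s} {s | v ∈ s} :=
      Set.disjoint_left.2 fun s h h' => h h'
    exact eq_neg_of_add_eq_zero_left (Submodule.disjoint_def.1
      (Finsupp.disjoint_supported_supported hdisj) _ h1 (heq ▸ h2))
  obtain ⟨a₁, ha₁, a₂, ha₂, haa⟩ :
      ∃ a₁ ∈ chainsIn A (n + 1), ∃ a₂ ∈ chainsIn B (n + 1), a₁ + a₂ = -a := by
    have hle : chainsIn D (n + 1) ≤ chainsIn A (n + 1) ⊔ chainsIn B (n + 1) := by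
      rw [chainsIn, chainsIn, chainsIn, ← Finsupp.supported_union]
      refine Finsupp.supported_mono fun s hs => ?_
      exact Or.imp (fun h => ⟨h, hs.2⟩) (fun h => ⟨h, hs.2⟩) (hDAB hs.1)
    exact Submodule.mem_sup.1 (hle (neg_mem ha))
  have hb12 : b - bdryAll V a₁ = bdryAll V a₂ := by
    rw [sub_eq_iff_eq_add', ← map_add, haa, map_neg, hab, neg_neg]
  obtain ⟨d, hd, hdb⟩ := hexAB (bdryAll V a₂) (by
    have h1 : bdryAll V a₂ ∈ chainsIn A n := hb12 ▸ sub_mem hb (bdryAll_mem_chainsIn hAd ha₁)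
    have h2 := bdryAll_mem_chainsIn hB ha₂
    have h := Submodule.mem_inf.2 ⟨h1, h2⟩
    rw [chainsIn, chainsIn, ← Finsupp.supported_inter] at h
    refine Finsupp.supported_mono ?_ h
    rintro s ⟨⟨hsA, hcard⟩, hsB, -⟩
    exact ⟨⟨hsA, hsB⟩, hcard⟩)
    (bdryAll_bdryAll _)
  have hf : a₁ + d ∈ chainsIn A (n + 1) :=
    add_mem ha₁ (chainsIn_mono Set.inter_subset_left _ hd)
  have hfb : bdryAll V (a₁ + d) = b := by rw [map_add, hdb, ← hb12]; abel
  obtain ⟨e, he, hee⟩ := hexD (a + (a₁ + d)) (add_mem ha (chainsIn_mono hAD _ hf))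
    (by rw [map_add, hab, hfb]; abel)
  refine ⟨e - cone v (a₁ + d), sub_mem (chainsIn_mono hDK _ he) (hconeA hf), ?_⟩
  rw [map_sub, hee, bdryAll_cone (fun s hs => hv s (hAD hs)) hf, hfb]
  abel

theorem bdryAll_chainIncl (X : SimplicialCpx V) (n : ℕ) (c : X.Chain (n + 1)) :
    bdryAll V (X.chainIncl (n + 1) c) = X.chainIncl n (X.bdry n c) := by
  have h : bdryAll V ∘ₗ X.chainIncl (n + 1) = X.chainIncl n ∘ₗ X.bdry n := by
    refine Finsupp.lhom_ext' fun s => LinearMap.ext_ring ?_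
    simp only [LinearMap.comp_apply, Finsupp.lsingle_apply, chainIncl, bdry,
      Finsupp.lmapDomain_apply, Finsupp.mapDomain_single, bdryAll_single, Finsupp.coe_lsum,
      LinearMap.toSpanSingleton_apply, zero_smul, Finsupp.sum_single_index, one_smul]
    rw [← Finsupp.lmapDomain_apply ℚ ℚ, map_sum]
    simp only [map_smul, Finsupp.lmapDomain_apply, Finsupp.mapDomain_single]
    exact (Finset.sum_attach s.1 fun v =>
      ((-1 : ℚ) ^ (s.1.filter (· < v)).card) • Finsupp.single (s.1.erase v) (1 : ℚ)).symm
  exact LinearMap.congr_fun h c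

theorem subsingleton_redH_of_exactAt (X : SimplicialCpx V) {n : ℕ}
    (h : ExactAt X.faces (n + 1)) : Subsingleton (X.redH (n + 1)) := by
  refine Submodule.Quotient.subsingleton_iff.2 (eq_top_iff.2 ?_)
  rintro ⟨z, hz⟩ -
  change z ∈ LinearMap.range (X.bdry (n + 1))
  have hz0 : X.bdry n z = 0 := hz
  obtain ⟨d, hd, hdz⟩ := h (X.chainIncl (n + 1) z)
    (by rw [← range_chainIncl]; exact LinearMap.mem_range_self _ z)
    (by rw [bdryAll_chainIncl, hz0, map_zero])
  rw [← range_chainIncl] at hd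
  obtain ⟨d, rfl⟩ := hd
  rw [bdryAll_chainIncl] at hdz
  exact ⟨d, X.chainIncl_injective _ hdz⟩

end SimplicialCpx

namespace SignedSet

variable {V : Type*} [DecidableEq V]

/-- The restriction of a signed set to the complement of `v`. -/
def erase (C : SignedSet V) (v : V) : SignedSet V :=
  ⟨C.pos.erase v, C.neg.erase v,
    Finset.disjoint_of_subset_left (Finset.erase_subset _ _)
      (Finset.disjoint_of_subset_right (Finset.erase_subset _ _) C.disj)⟩

theorem support_erase (C : SignedSet V) (v : V) : (C.erase v).support = C.support.erase v :=
  (Finset.erase_union_distrib _ _ _).symm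

/-- A symmetric family of nonempty signed sets satisfying weak elimination. Unlike signed
circuits, its members need not have incomparable supports. -/
structure IsEliminative (F : Set (SignedSet V)) : Prop where
  support_nonempty : ∀ C ∈ F, C.support.Nonempty
  negate_mem : ∀ C ∈ F, C.negate ∈ F
  elimination : ∀ C ∈ F, ∀ D ∈ F, C ≠ D.negate → ∀ e ∈ C.pos ∩ D.neg, ∃ Z ∈ F,
    Z.pos ⊆ (C.pos ∪ D.pos).erase e ∧ Z.neg ⊆ (C.neg ∪ D.neg).erase e

/-- The contraction of a family of signed sets at `v`. -/
def contract (F : Set (SignedSet V)) (v : V) : Set (SignedSet V) :=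
  (fun C => C.erase v) '' F

theorem IsEliminative.contract {F : Set (SignedSet V)} (hF : IsEliminative F) {v : V}
    (hv : ∀ C ∈ F, ¬ C.support ⊆ {v}) : IsEliminative (contract F v) where
  support_nonempty := by
    rintro _ ⟨C, hC, rfl⟩
    rw [support_erase, Finset.nonempty_iff_ne_empty, Ne, Finset.erase_eq_empty_iff, not_or]
    exact ⟨(hF.support_nonempty C hC).ne_empty, fun h => hv C hC h.subset⟩
  negate_mem := by
    rintro _ ⟨C, hC, rfl⟩
    exact ⟨C.negate, hF.negate_mem C hC, rfl⟩
  elimination := by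
    rintro _ ⟨C, hC, rfl⟩ _ ⟨D, hD, rfl⟩ hne e he
    obtain ⟨Z, hZ, hpos, hneg⟩ := hF.elimination C hC D hD (fun h => hne (by rw [h]; rfl)) e
      (Finset.inter_subset_inter (Finset.erase_subset _ _) (Finset.erase_subset _ _) he)
    refine ⟨Z.erase v, ⟨Z, hZ, rfl⟩, ?_, ?_⟩
    · change Z.pos.erase v ⊆ (C.pos.erase v ∪ D.pos.erase v).erase e
      rw [← Finset.erase_union_distrib, Finset.erase_right_comm]
      exact Finset.erase_subset_erase v hpos
    · change Z.neg.erase v ⊆ (C.neg.erase v ∪ D.neg.erase v).erase e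
      rw [← Finset.erase_union_distrib, Finset.erase_right_comm]
      exact Finset.erase_subset_erase v hneg

/-- The subsets of `E` containing no positive member of `F`. -/
def acyclicSets (F : Set (SignedSet V)) (E : Finset V) : Set (Finset V) :=
  {S | S ⊆ E ∧ ∀ C ∈ F, C.neg = ∅ → ¬ C.pos ⊆ S}

theorem acyclicSets_down_closed {F : Set (SignedSet V)} {E : Finset V} :
    ∀ s ∈ acyclicSets F E, ∀ t ⊆ s, t ∈ acyclicSets F E :=
  fun _ hs _ ht => ⟨ht.trans hs.1, fun C hC h h' => hs.2 C hC h (h'.trans ht)⟩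

end SignedSet

namespace SignedSet

variable {V : Type*} [LinearOrder V]

open SimplicialCpx

theorem exactAt_acyclicSets (E : Finset V) : ∀ {F : Set (SignedSet V)}, IsEliminative F →
    ∀ {n : ℕ}, (∀ S ⊆ E, (∀ C ∈ F, ¬ C.support ⊆ S) → S.card < n) →
      ExactAt (acyclicSets F E) n := by
  induction E using Finset.induction_on_min with
  | empty =>
    intro F hF n hn
    have hn0 : 0 < n := hn ∅ (Finset.Subset.refl _) fun C hC h =>
      (hF.support_nonempty C hC).ne_empty (Finset.subset_empty.1 h)
    intro c hc _
    have hempty : {s : Finset V | s ∈ acyclicSets F ∅ ∧ s.card = n} = ∅ := by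
      ext s
      simp only [Set.mem_ofPred_eq, Set.mem_empty_iff_false, iff_false, not_and]
      intro hs hcard
      rw [Finset.subset_empty.1 hs.1, Finset.card_empty] at hcard
      omega
    rw [chainsIn, hempty, Finsupp.supported_empty, Submodule.mem_bot] at hc
    exact ⟨0, zero_mem _, by rw [hc, map_zero]⟩
  | insert v E hv ih =>
    intro F hF n hn
    have hvE : v ∉ E := fun h => lt_irrefl _ (hv v h)
    have hexE : ExactAt (acyclicSets F E) n :=
      ih hF fun S hS => hn S (hS.trans (Finset.subset_insert v E))
    by_cases hloop : ∃ C ∈ F, C.support ⊆ {v}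
    · have hpos : ∃ C ∈ F, C.neg = ∅ ∧ C.pos ⊆ {v} := by
        obtain ⟨C, hC, hCv⟩ := hloop
        have hp : C.pos ⊆ {v} := Finset.subset_union_left.trans hCv
        have hq : C.neg ⊆ {v} := Finset.subset_union_right.trans hCv
        rcases Finset.subset_singleton_iff.1 hq with h | h
        · exact ⟨C, hC, h, hp⟩
        · refine ⟨C.negate, hF.negate_mem C hC, ?_, hq⟩
          change C.pos = ∅
          rcases Finset.subset_singleton_iff.1 hp with h' | h'
          · exact h'
          · have := C.disj
            rw [h, h'] at this
            simp at this
      obtain ⟨C, hC, hneg, hpos⟩ := hpos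
      have heq : acyclicSets F (insert v E) = acyclicSets F E := by
        ext S
        refine and_congr_left fun h => ⟨fun hS => ?_, fun hS => hS.trans (Finset.subset_insert v E)⟩
        refine (Finset.subset_insert_iff_of_notMem fun hvS => ?_).1 hS
        exact h C hC hneg (hpos.trans (Finset.singleton_subset_iff.2 hvS))
      rwa [heq]
    · push Not at hloop
      obtain _ | n := n
      · exact absurd (hn ∅ (Finset.empty_subset _) fun C hC h =>
          (hF.support_nonempty C hC).ne_empty (Finset.subset_empty.1 h)) (Nat.not_lt_zero _)
      have hexc : ExactAt (acyclicSets (contract F v) E) n := by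
        refine ih (hF.contract hloop) fun S hS hind => ?_
        have h := hn (insert v S) (Finset.insert_subset_insert v hS) fun C hC hCS =>
          hind _ ⟨C, hC, rfl⟩ (by rw [support_erase]; exact Finset.subset_insert_iff.1 hCS)
        rw [Finset.card_insert_of_notMem fun h => hvE (hS h)] at h
        omega
      have hD : acyclicSets F E = {s ∈ acyclicSets F (insert v E) | v ∉ s} := by
        ext S
        refine ⟨fun h => ⟨⟨h.1.trans (Finset.subset_insert v E), h.2⟩, fun h' => hvE (h.1 h')⟩, ?_⟩
        rintro ⟨h, hvS⟩
        exact ⟨(Finset.subset_insert_iff_of_notMem hvS).1 h.1, h.2⟩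
      have hinter : {s | v ∉ s ∧ insert v s ∈ acyclicSets F (insert v E)} ∩
          {s | ∀ C ∈ F, C.neg ⊆ {v} → ¬ C.pos ⊆ s} = acyclicSets (contract F v) E := by
        ext S
        constructor
        · rintro ⟨⟨hvS, hSE, hS⟩, hS'⟩
          refine ⟨(Finset.insert_subset_insert_iff hvS).1 hSE, ?_⟩
          rintro _ ⟨C, hC, rfl⟩ hneg hpos
          replace hneg : C.neg ⊆ {v} := by
            rw [← insert_empty_eq, Finset.subset_insert_iff]; exact hneg.subset
          replace hpos : C.pos ⊆ insert v S := Finset.subset_insert_iff.2 hpos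
          rcases Finset.subset_singleton_iff.1 hneg with h | h
          · exact hS C hC h hpos
          · refine hS' C hC hneg ((Finset.subset_insert_iff_of_notMem ?_).1 hpos)
            exact Finset.disjoint_right.1 C.disj (by simp [h])
        · rintro ⟨hSE, hS⟩
          have key : ∀ C ∈ F, C.neg ⊆ {v} → ¬ C.pos ⊆ insert v S := fun C hC hneg hpos =>
            hS _ ⟨C, hC, rfl⟩
              (by
                rw [← insert_empty_eq, Finset.subset_insert_iff] at hneg
                exact Finset.subset_empty.1 hneg)
              (Finset.subset_insert_iff.1 hpos)
          exact ⟨⟨fun h => hvE (hSE h), Finset.insert_subset_insert v hSE,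
            fun C hC hneg => key C hC (by simp [hneg])⟩,
            fun C hC hneg hpos => key C hC hneg (hpos.trans (Finset.subset_insert v S))⟩
      refine ExactAt.of_link_union hD rfl acyclicSets_down_closed
        (B := {s | ∀ C ∈ F, C.neg ⊆ {v} → ¬ C.pos ⊆ s})
        (fun s hs t ht C hC h h' => hs C hC h (h'.trans ht))
        (fun s hs u hu => hv u (hs.1 hu)) ?_ hexE (hinter ▸ hexc)
      rintro S ⟨hSE, hS⟩
      by_contra hnot
      rw [Set.mem_union, not_or] at hnot
      obtain ⟨hnA, hnB⟩ := hnot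
      have hvS : v ∉ S := fun h => hvE (hSE h)
      obtain ⟨C, hC, hCneg, hCpos⟩ : ∃ C ∈ F, C.neg = ∅ ∧ C.pos ⊆ insert v S := by
        by_contra! h
        exact hnA ⟨hvS, Finset.insert_subset_insert v hSE, h⟩
      obtain ⟨D, hD, hDneg, hDpos⟩ : ∃ D ∈ F, D.neg ⊆ {v} ∧ D.pos ⊆ S := by
        by_contra! h
        exact hnB h
      have hvC : v ∈ C.pos := by
        by_contra h
        exact hS C hC hCneg ((Finset.subset_insert_iff_of_notMem h).1 hCpos)
      have hvD : D.neg = {v} :=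
        (Finset.subset_singleton_iff.1 hDneg).resolve_left fun h => hS D hD h hDpos
      have hne : C ≠ D.negate := by
        rintro rfl
        refine hloop D hD (Finset.union_subset ?_ hDneg)
        rw [show D.pos = ∅ from hCneg]
        exact Finset.empty_subset _
      obtain ⟨Z, hZ, hZpos, hZneg⟩ := hF.elimination C hC D hD hne v (by simp [hvC, hvD])
      refine hS Z hZ ?_ (hZpos.trans ?_)
      · rw [hCneg, hvD] at hZneg
        simpa using hZneg
      · exact Finset.subset_insert_iff.1
          (Finset.union_subset hCpos (hDpos.trans (Finset.subset_insert v S)))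

end SignedSet

/-- For a loopless oriented matroid `M` of rank `r` on a finite ground set with
support complex `X`, the reduced homology `H̃ⱼ(X;ℚ)` vanishes for all `j ≥ r`
(in our indexing, `redH n = H̃_{n-1}` vanishes for all `n ≥ r + 1`). -/
theorem suppComplex_homology_vanish {V : Type*} [LinearOrder V] [Fintype V]
    (M : OrientedMatroid V) (hM : M.Loopless) (r : ℕ) (hr : M.rank = r) :
    ∀ n : ℕ, r < n → Subsingleton (M.suppComplex.redH n) := by
  rintro (_ | n) hn
  · omega
  refine SimplicialCpx.subsingleton_redH_of_exactAt _ ?_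
  have hfaces : M.suppComplex.faces = SignedSet.acyclicSets M.Circuits Finset.univ := by
    ext S
    refine ⟨fun h => ⟨Finset.subset_univ S, fun C hC hneg hpos => h _ hpos ⟨C, hC, hneg, rfl⟩⟩, ?_⟩
    rintro ⟨-, h⟩ T hT ⟨C, hC, hneg, rfl⟩
    exact h C hC hneg hT
  rw [hfaces]
  refine SignedSet.exactAt_acyclicSets _
    ⟨M.support_nonempty, M.negate_mem, M.elimination⟩ fun S _ hS => lt_of_le_of_lt ?_ hn
  rw [← hr]
  refine le_csSup ⟨Fintype.card V, ?_⟩ ⟨S, hS, rfl⟩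
  rintro _ ⟨T, -, rfl⟩
  exact T.card_le_univ
end

section
/- Let M be a loopless oriented matroid of rank r on finite ground set V, X its support complex, and S ∈ X a non-empty simplex. Then H̃_j(lk(S, X); ℚ) = 0 for all j ≥ r − 1. -/
/-- The simplicial boundary on rational combinations of arbitrary finite subsets of `V`. -/
noncomputable def finsetBdry (V : Type*) [LinearOrder V] :
    (Finset V →₀ ℚ) →ₗ[ℚ] (Finset V →₀ ℚ) :=
  Finsupp.lsum ℚ fun s => LinearMap.toSpanSingleton ℚ _
    (∑ v ∈ s, ((-1 : ℚ) ^ (s.filter (· < v)).card) • Finsupp.single (s.erase v) (1 : ℚ))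

/-- The chains spanned by the members of `K` of cardinality `n`. -/
def chainsIn {V : Type*} (K : Set (Finset V)) (n : ℕ) : Submodule ℚ (Finset V →₀ ℚ) :=
  Finsupp.supported ℚ ℚ {s | s ∈ K ∧ s.card = n}

/-- Every cycle on the members of `K` of cardinality `n` is the boundary of a chain in `K`. -/
def CyclesBound {V : Type*} [LinearOrder V] (K : Set (Finset V)) (n : ℕ) : Prop :=
  ∀ z ∈ chainsIn K n, finsetBdry V z = 0 → ∃ b ∈ chainsIn K (n + 1), finsetBdry V b = z

/-- The map on chains that joins every set with the vertex `e`. -/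
noncomputable def chainCone {V : Type*} [DecidableEq V] (e : V) :
    (Finset V →₀ ℚ) →ₗ[ℚ] (Finset V →₀ ℚ) :=
  Finsupp.lmapDomain ℚ ℚ (insert e)

section Chains

variable {V : Type*}

lemma single_mem_chainsIn {K : Set (Finset V)} {n : ℕ} {s : Finset V} (hs : s ∈ K)
    (hn : s.card = n) (a : ℚ) : Finsupp.single s a ∈ chainsIn K n :=
  Finsupp.single_mem_supported ℚ a ⟨hs, hn⟩

lemma chainsIn_mono {K L : Set (Finset V)} (h : K ⊆ L) (n : ℕ) : chainsIn K n ≤ chainsIn L n :=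
  Finsupp.supported_mono fun _ hs => ⟨h hs.1, hs.2⟩

lemma chainsIn_inter {K L : Set (Finset V)} {n : ℕ} {z : Finset V →₀ ℚ}
    (hK : z ∈ chainsIn K n) (hL : z ∈ chainsIn L n) : z ∈ chainsIn (K ∩ L) n := by
  rw [chainsIn, Finsupp.mem_supported] at *
  exact fun s hs => ⟨⟨(hK hs).1, (hL hs).1⟩, (hK hs).2⟩

lemma chainsIn_le {K : Set (Finset V)} {n : ℕ} {p : Submodule ℚ (Finset V →₀ ℚ)}
    (h : ∀ s ∈ K, s.card = n → Finsupp.single s (1 : ℚ) ∈ p) : chainsIn K n ≤ p := by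
  rw [chainsIn, Finsupp.supported_eq_span_single, Submodule.span_le]
  rintro _ ⟨s, hs, rfl⟩
  exact h s hs.1 hs.2

variable [LinearOrder V]

lemma cyclesBound_empty (n : ℕ) : CyclesBound (∅ : Set (Finset V)) n := by
  intro z hz _
  have : z = 0 := by simpa [chainsIn] using hz
  exact ⟨0, zero_mem _, by simp [this]⟩

lemma finsetBdry_single (s : Finset V) (a : ℚ) :
    finsetBdry V (Finsupp.single s a) =
      a • ∑ v ∈ s, ((-1 : ℚ) ^ (s.filter (· < v)).card) • Finsupp.single (s.erase v) (1 : ℚ) := by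
  simp [finsetBdry]

lemma finsetBdry_mem_chainsIn {K : Set (Finset V)} (hK : ∀ s ∈ K, ∀ t ⊆ s, t ∈ K) {n : ℕ}
    {z : Finset V →₀ ℚ} (hz : z ∈ chainsIn K (n + 1)) : finsetBdry V z ∈ chainsIn K n := by
  suffices h : chainsIn K (n + 1) ≤ (chainsIn K n).comap (finsetBdry V) from h hz
  refine chainsIn_le fun s hs hn => ?_
  rw [Submodule.mem_comap, finsetBdry_single, one_smul]
  refine Submodule.sum_mem _ fun v hv => Submodule.smul_mem _ _ (single_mem_chainsIn ?_ ?_ _)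
  · exact hK s hs _ (Finset.erase_subset _ _)
  · rw [Finset.card_erase_of_mem hv, hn, Nat.add_sub_cancel]

lemma chainCone_mem_chainsIn {K L : Set (Finset V)} {e : V} {n : ℕ}
    (h : ∀ s ∈ L, e ∉ s ∧ insert e s ∈ K) {z : Finset V →₀ ℚ} (hz : z ∈ chainsIn L n) :
    chainCone e z ∈ chainsIn K (n + 1) := by
  suffices h : chainsIn L n ≤ (chainsIn K (n + 1)).comap (chainCone e) from h hz
  refine chainsIn_le fun s hs hn => ?_
  rw [Submodule.mem_comap, chainCone, Finsupp.lmapDomain_apply, Finsupp.mapDomain_single]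
  exact single_mem_chainsIn (h s hs).2 (by rw [Finset.card_insert_of_notMem (h s hs).1, hn]) _

lemma finsetBdry_single_insert {e : V} {s : Finset V} (hs : ∀ v ∈ s, e < v) :
    finsetBdry V (Finsupp.single (insert e s) 1) =
      Finsupp.single s 1 - chainCone e (finsetBdry V (Finsupp.single s 1)) := by
  have he : e ∉ s := fun h => lt_irrefl _ (hs e h)
  have h0 : (insert e s).filter (· < e) = ∅ := by
    refine Finset.filter_eq_empty_iff.2 fun v hv => ?_
    rcases Finset.mem_insert.1 hv with rfl | hv
    · exact lt_irrefl _
    · exact (hs v hv).not_gt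
  rw [finsetBdry_single, finsetBdry_single, one_smul, one_smul, Finset.sum_insert he, h0,
    Finset.erase_insert he, map_sum, sub_eq_add_neg, ← Finset.sum_neg_distrib]
  congr 1
  · simp
  · refine Finset.sum_congr rfl fun v hv => ?_
    have hne : e ≠ v := (hs v hv).ne
    rw [Finset.filter_insert, if_pos (hs v hv), Finset.card_insert_of_notMem (by simp [he]),
      pow_succ, map_smul, chainCone, Finsupp.lmapDomain_apply, Finsupp.mapDomain_single,
      Finset.erase_insert_of_ne hne]
    simp

lemma finsetBdry_chainCone {K : Set (Finset V)} {e : V} {n : ℕ} (hK : ∀ s ∈ K, ∀ v ∈ s, e < v)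
    {z : Finset V →₀ ℚ} (hz : z ∈ chainsIn K n) :
    finsetBdry V (chainCone e z) = z - chainCone e (finsetBdry V z) := by
  suffices h : chainsIn K n ≤ LinearMap.eqLocus (finsetBdry V ∘ₗ chainCone e)
      (LinearMap.id - chainCone e ∘ₗ finsetBdry V) from h hz
  refine chainsIn_le fun s hs _ => ?_
  simpa [LinearMap.mem_eqLocus, chainCone, Finsupp.lmapDomain_apply, Finsupp.mapDomain_single]
    using finsetBdry_single_insert (hK s hs)

lemma finsetBdry_finsetBdry (z : Finset V →₀ ℚ) : finsetBdry V (finsetBdry V z) = 0 := by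
  suffices h : finsetBdry V ∘ₗ finsetBdry V = 0 from LinearMap.congr_fun h z
  refine Finsupp.lhom_ext' fun s => LinearMap.ext_ring ?_
  simp only [LinearMap.comp_apply, Finsupp.lsingle_apply, LinearMap.zero_apply]
  induction s using Finset.induction_on_min with
  | empty => simp [finsetBdry_single]
  | insert e s hs ih =>
    have hd : finsetBdry V (Finsupp.single s 1) ∈ chainsIn {t | t ⊆ s} (s.card - 1) := by
      rcases s.eq_empty_or_nonempty with rfl | hne
      · simp [finsetBdry_single]
      · refine finsetBdry_mem_chainsIn (fun a ha b hb => hb.trans ha)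
          (single_mem_chainsIn (Finset.Subset.refl s) ?_ _)
        have := hne.card_pos
        omega
    rw [finsetBdry_single_insert hs, map_sub,
      finsetBdry_chainCone (fun t (ht : t ⊆ s) v hv => hs v (ht hv)) hd, ih]
    simp

/-- If `e` is the least vertex of `K`, the link `L` of `e` and the family `B` cover the deletion
of `e`, and the cycles of `B` and `L ∩ B` bound in consecutive degrees, then so do those of `K`. -/
lemma CyclesBound.of_cover {K L B : Set (Finset V)} {e : V} {n : ℕ}
    (hL : ∀ s ∈ L, ∀ t ⊆ s, t ∈ L) (hB : ∀ s ∈ B, ∀ t ⊆ s, t ∈ B)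
    (heL : ∀ s ∈ L, ∀ v ∈ s, e < v) (heB : ∀ s ∈ B, e ∉ s) (hBK : B ⊆ K)
    (hLK : ∀ s ∈ L, insert e s ∈ K) (hKL : ∀ s ∈ K, e ∈ s → s.erase e ∈ L)
    (hcover : ∀ s ∈ K, e ∉ s → s ∈ L ∨ s ∈ B)
    (hLB : CyclesBound (L ∩ B) n) (hBn : CyclesBound B (n + 1)) : CyclesBound K (n + 1) := by
  have heL' : ∀ s ∈ L, e ∉ s := fun s hs he => lt_irrefl _ (heL s hs e he)
  have hdecomp : ∀ z ∈ chainsIn K (n + 1), ∃ x ∈ chainsIn L n, ∃ u ∈ chainsIn L (n + 1),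
      ∃ w ∈ chainsIn B (n + 1), z = chainCone e x + u + w := by
    have hle : chainsIn K (n + 1) ≤
        (chainsIn L n).map (chainCone e) ⊔ chainsIn L (n + 1) ⊔ chainsIn B (n + 1) := by
      refine chainsIn_le fun s hs hn => ?_
      by_cases he : e ∈ s
      · refine Submodule.mem_sup_left (Submodule.mem_sup_left
          ⟨Finsupp.single (s.erase e) 1, single_mem_chainsIn (hKL s hs he) ?_ _, ?_⟩)
        · rw [Finset.card_erase_of_mem he, hn, Nat.add_sub_cancel]
        · rw [chainCone, Finsupp.lmapDomain_apply, Finsupp.mapDomain_single,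
            Finset.insert_erase he]
      · rcases hcover s hs he with h | h
        · exact Submodule.mem_sup_left (Submodule.mem_sup_right (single_mem_chainsIn h hn _))
        · exact Submodule.mem_sup_right (single_mem_chainsIn h hn _)
    intro z hz
    obtain ⟨_, h1, w, hw, rfl⟩ := Submodule.mem_sup.1 (hle hz)
    obtain ⟨_, ⟨x, hx, rfl⟩, u, hu, rfl⟩ := Submodule.mem_sup.1 h1
    exact ⟨x, hx, u, hu, w, hw, rfl⟩
  intro z hz hdz
  obtain ⟨x, hx, u, hu, w, hw, rfl⟩ := hdecomp z hz
  have hdu := finsetBdry_mem_chainsIn hL hu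
  have hdw := finsetBdry_mem_chainsIn hB hw
  rw [map_add, map_add, finsetBdry_chainCone heL hx] at hdz
  have hsum : x + finsetBdry V u + finsetBdry V w = 0 := by
    have hcone : chainCone e (finsetBdry V x) = x + finsetBdry V u + finsetBdry V w := by
      rw [eq_comm, ← sub_eq_zero, ← hdz]
      abel
    have hmem : x + finsetBdry V u + finsetBdry V w ∈
        Finsupp.supported ℚ ℚ {s : Finset V | e ∉ s} :=
      add_mem (add_mem (Finsupp.supported_mono (fun s hs => heL' s hs.1) hx)
        (Finsupp.supported_mono (fun s hs => heL' s hs.1) hdu))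
        (Finsupp.supported_mono (fun s hs => heB s hs.1) hdw)
    ext s
    by_cases he : e ∈ s
    · exact (Finsupp.mem_supported' ℚ _).1 hmem s (by simpa using he)
    · rw [← hcone, chainCone, Finsupp.lmapDomain_apply, Finsupp.mapDomain_of_notMem_range]
      · rfl
      · rintro ⟨t, rfl⟩
        exact he (Finset.mem_insert_self _ _)
  have hdwL : finsetBdry V w ∈ chainsIn L n := by
    have : finsetBdry V w = -(x + finsetBdry V u) := (neg_eq_of_add_eq_zero_right hsum).symm
    rw [this]
    exact neg_mem (add_mem hx hdu)
  obtain ⟨c, hc, hdc⟩ := hLB _ (chainsIn_inter hdwL hdw) (finsetBdry_finsetBdry w)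
  have hcL := chainsIn_mono Set.inter_subset_left _ hc
  have hcB := chainsIn_mono Set.inter_subset_right _ hc
  obtain ⟨b, hb, hdb⟩ := hBn (w - c) (sub_mem hw hcB) (by rw [map_sub, hdc, sub_self])
  refine ⟨chainCone e (u + c) + b, add_mem (chainCone_mem_chainsIn
    (fun s hs => ⟨heL' s hs, hLK s hs⟩) (add_mem hu hcL)) (chainsIn_mono hBK _ hb), ?_⟩
  have hx' : finsetBdry V (u + c) = -x := by
    rw [map_add, hdc, eq_neg_iff_add_eq_zero, ← hsum]
    abel
  rw [map_add, finsetBdry_chainCone heL (add_mem hu hcL), hx', hdb, map_neg]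
  abel

namespace SimplicialCpx

lemma mapDomain_bdry (X : SimplicialCpx V) (n : ℕ) (c : X.Chain (n + 1)) :
    (X.bdry n c).mapDomain Subtype.val = finsetBdry V (c.mapDomain Subtype.val) := by
  suffices h : Finsupp.lmapDomain ℚ ℚ Subtype.val ∘ₗ X.bdry n =
      finsetBdry V ∘ₗ Finsupp.lmapDomain ℚ ℚ Subtype.val from LinearMap.congr_fun h c
  refine Finsupp.lhom_ext' fun s => LinearMap.ext_ring ?_
  simp only [LinearMap.comp_apply, Finsupp.lsingle_apply, Finsupp.lmapDomain_apply,
    Finsupp.mapDomain_single, finsetBdry_single, one_smul]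
  rw [bdry, Finsupp.lsum_single, LinearMap.toSpanSingleton_apply, one_smul,
    ← Finsupp.lmapDomain_apply ℚ ℚ, map_sum, ← Finset.sum_attach s.1]
  refine Finset.sum_congr rfl fun v _ => ?_
  rw [map_smul, Finsupp.lmapDomain_apply, Finsupp.mapDomain_single]

lemma subsingleton_redH {X : SimplicialCpx V} {n : ℕ} (h : CyclesBound X.faces n) :
    Subsingleton (X.redH n) := by
  refine Submodule.Quotient.subsingleton_iff.2 (eq_top_iff.2 ?_)
  rintro ⟨z, hz⟩ -
  have hz' : finsetBdry V (z.mapDomain Subtype.val) = 0 := by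
    cases n with
    | zero =>
      induction z using Finsupp.induction_linear with
      | zero => simp
      | add f g hf hg =>
        rw [Finsupp.mapDomain_add, map_add, hf trivial, hg trivial, add_zero]
      | single s a =>
        have : s.1 = ∅ := Finset.card_eq_zero.1 s.2.2
        rw [Finsupp.mapDomain_single, this, finsetBdry_single]
        simp
    | succ m =>
      have : X.bdry m z = 0 := hz
      rw [← mapDomain_bdry, this, Finsupp.mapDomain_zero]
  have hmem : z.mapDomain Subtype.val ∈ chainsIn X.faces n := by
    rw [chainsIn, Finsupp.mem_supported]
    intro s hs
    obtain ⟨t, -, rfl⟩ := Finset.mem_image.1 (Finsupp.mapDomain_support hs)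
    exact t.2
  obtain ⟨b, hb, hdb⟩ := h _ hmem hz'
  refine ⟨b.comapDomain Subtype.val Subtype.val_injective.injOn, Finsupp.mapDomain_injective Subtype.val_injective ?_⟩
  rw [mapDomain_bdry]
  refine Eq.trans ?_ hdb
  congr 1
  exact Finsupp.mapDomain_comapDomain _ Subtype.val_injective _
    fun s hs => ⟨⟨s, hb hs⟩, rfl⟩

end SimplicialCpx

namespace OrientedMatroid

/-- The subsets `R` of `W` for which no circuit has its positive part in `P ∪ R` and its negative
part in `N`. The elements of `P ∩ N` are contracted, the other elements of `P` have to be positive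
and those of `N` negative. -/
def signedLink (M : OrientedMatroid V) (P N W : Finset V) : Set (Finset V) :=
  {R | R ⊆ W ∧ ∀ C ∈ M.Circuits, C.pos ⊆ P ∪ R → ¬ C.neg ⊆ N}

variable {M : OrientedMatroid V} {P N W R : Finset V} {e : V}

lemma signedLink_down_closed :
    ∀ s ∈ M.signedLink P N W, ∀ t ⊆ s, t ∈ M.signedLink P N W := fun _ hs _ hts =>
  ⟨hts.trans hs.1, fun C hC hp => hs.2 C hC (hp.trans (Finset.union_subset_union_right hts))⟩

lemma mem_signedLink_insert_or (hW : Disjoint W (P ∪ N))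
    (h0 : ∅ ∈ M.signedLink (insert e P) N W) (hR : R ∈ M.signedLink P N W) :
    R ∈ M.signedLink (insert e P) N W ∨ R ∈ M.signedLink P (insert e N) W := by
  by_contra! hcon
  obtain ⟨h1, h2⟩ := hcon
  simp only [signedLink, Set.mem_ofPred_eq, not_and, not_forall, not_not] at h1 h2
  obtain ⟨C, hC, hCp, hCn⟩ := h1 hR.1
  obtain ⟨D, hD, hDp, hDn⟩ := h2 hR.1
  have hRN : ∀ x ∈ R, x ∉ N := fun x hx hxN =>
    Finset.disjoint_left.1 hW (hR.1 hx) (Finset.mem_union_right _ hxN)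
  have heC : e ∈ C.pos := by
    by_contra he
    refine hR.2 C hC (fun x hx => ?_) hCn
    have hne : x ≠ e := fun h => he (h ▸ hx)
    simpa [hne] using hCp hx
  have heD : e ∈ D.neg := by
    by_contra he
    exact hR.2 D hD hDp ((Finset.subset_insert_iff_of_notMem he).1 hDn)
  by_cases hCD : C = D.negate
  · refine h0.2 C hC (fun x hx => ?_) hCn
    have hx1 := hCp hx
    have hx2 : x ∈ insert e N := hDn (by rw [hCD] at hx; exact hx)
    have := hRN x
    simp only [Finset.mem_insert, Finset.mem_union, Finset.notMem_empty] at *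
    tauto
  · obtain ⟨Z, hZ, hZp, hZn⟩ := M.elimination C hC D hD hCD e (Finset.mem_inter.2 ⟨heC, heD⟩)
    refine hR.2 Z hZ (fun x hx => ?_) (fun x hx => ?_)
    · have h := hZp hx
      have h1 := @hCp x
      have h2 := @hDp x
      simp only [Finset.mem_erase, Finset.mem_insert, Finset.mem_union] at *
      tauto
    · have h := hZn hx
      have h1 := @hCn x
      have h2 := @hDn x
      simp only [Finset.mem_erase, Finset.mem_insert, Finset.mem_union] at *
      tauto

lemma signedLink_inter :
    M.signedLink (insert e P) N W ∩ M.signedLink P (insert e N) W =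
      M.signedLink (insert e P) (insert e N) W := by
  ext R
  constructor
  · rintro ⟨h1, h2⟩
    refine ⟨h1.1, fun C hC hp hn => ?_⟩
    by_cases he : e ∈ C.neg
    · have he' : e ∉ C.pos := fun h => Finset.disjoint_left.1 C.disj h he
      rw [Finset.insert_union] at hp
      exact h2.2 C hC ((Finset.subset_insert_iff_of_notMem he').1 hp) hn
    · exact h1.2 C hC hp ((Finset.subset_insert_iff_of_notMem he).1 hn)
  · refine fun h => ⟨⟨h.1, fun C hC hp hn => ?_⟩, ⟨h.1, fun C hC hp hn => ?_⟩⟩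
    · exact h.2 C hC hp (hn.trans (Finset.subset_insert _ _))
    · exact h.2 C hC (hp.trans
        (Finset.union_subset_union_left (Finset.subset_insert _ _))) hn

lemma indep_insert_inter (h0 : ∅ ∈ M.signedLink P N W) {a : V} (ha : a ∈ P ∪ N) :
    M.Indep (insert a (P ∩ N)) := by
  intro C hC hsub
  have hp : ∀ x ∈ C.pos, x ∈ insert a (P ∩ N) := fun x hx => hsub (Finset.mem_union_left _ hx)
  have hn : ∀ x ∈ C.neg, x ∈ insert a (P ∩ N) := fun x hx => hsub (Finset.mem_union_right _ hx)
  have hd : a ∈ C.pos → a ∉ C.neg := fun h => Finset.disjoint_left.1 C.disj h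
  have h1 : ¬ (C.pos ⊆ P ∧ C.neg ⊆ N) := fun h =>
    h0.2 C hC (by simpa using h.1) h.2
  have h2 : ¬ (C.neg ⊆ P ∧ C.pos ⊆ N) := fun h =>
    h0.2 C.negate (M.negate_mem C hC) (by simpa [SignedSet.negate] using h.1) h.2
  grind

/-- The cycles of a signed link bound in cardinality at least the rank of the contraction by
`P ∩ N`, provided the elements of `P ∪ N` are not all contracted. -/
theorem cyclesBound_signedLink (M : OrientedMatroid V) {r : ℕ}
    (hr : ∀ I, M.Indep I → I.card ≤ r) (W P N : Finset V) (hW : Disjoint W (P ∪ N))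
    (hPN : ∃ a ∈ P ∪ N, a ∉ P ∩ N) (h0 : ∅ ∈ M.signedLink P N W) (n : ℕ)
    (hn : r ≤ n + (P ∩ N).card) : CyclesBound (M.signedLink P N W) n := by
  induction W using Finset.induction_on_min generalizing P N n with
  | empty =>
    obtain ⟨a, ha, ha'⟩ := hPN
    have hcard := hr _ (indep_insert_inter h0 ha)
    rw [Finset.card_insert_of_notMem ha'] at hcard
    refine fun z hz _ => ⟨0, zero_mem _, ?_⟩
    have hempty : {s | s ∈ M.signedLink P N ∅ ∧ s.card = n} = ∅ := by
      refine Set.eq_empty_of_forall_notMem fun s hs => ?_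
      have : s.card = 0 := by rw [Finset.subset_empty.1 hs.1.1, Finset.card_empty]
      have := hs.2
      omega
    rw [chainsIn, hempty, Finsupp.supported_empty, Submodule.mem_bot] at hz
    rw [hz, map_zero]
  | insert e W he ih =>
    have heW : e ∉ W := fun h => lt_irrefl _ (he e h)
    have hWd : Disjoint W (P ∪ N) := Finset.disjoint_of_subset_left (Finset.subset_insert _ _) hW
    have hePN : e ∉ P ∪ N := Finset.disjoint_left.1 hW (Finset.mem_insert_self _ _)
    have heP : e ∉ P := fun h => hePN (Finset.mem_union_left _ h)
    have heN : e ∉ N := fun h => hePN (Finset.mem_union_right _ h)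
    obtain ⟨a, ha, ha'⟩ := hPN
    have hae : a ≠ e := fun h => hePN (h ▸ ha)
    have h0W : ∅ ∈ M.signedLink P N W := ⟨Finset.empty_subset _, h0.2⟩
    by_cases h1 : ∅ ∈ M.signedLink (insert e P) N W
    · obtain ⟨m, rfl⟩ : ∃ m, n = m + 1 := by
        refine Nat.exists_eq_succ_of_ne_zero ?_
        have hcard := hr _ (indep_insert_inter h0 ha)
        rw [Finset.card_insert_of_notMem ha'] at hcard
        omega
      have hins : insert e P ∩ insert e N = insert e (P ∩ N) := by
        rw [Finset.insert_inter_distrib]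
      refine CyclesBound.of_cover (e := e) (L := M.signedLink (insert e P) N W)
        (B := M.signedLink P (insert e N) W) signedLink_down_closed signedLink_down_closed
        (fun s hs v hv => he v (hs.1 hv)) (fun s hs h => heW (hs.1 h)) (fun s hs => ?_)
        (fun s hs => ?_) (fun s hs hes => ?_) (fun s hs hes => ?_) ?_ ?_
      · exact ⟨hs.1.trans (Finset.subset_insert _ _), fun C hC hp hn =>
          hs.2 C hC hp (hn.trans (Finset.subset_insert _ _))⟩
      · refine ⟨Finset.insert_subset_insert _ hs.1, fun C hC hp => hs.2 C hC ?_⟩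
        rwa [Finset.insert_union, ← Finset.union_insert]
      · refine ⟨Finset.subset_insert_iff.1 hs.1, fun C hC hp => hs.2 C hC ?_⟩
        rwa [Finset.insert_union, ← Finset.union_insert, Finset.insert_erase hes] at hp
      · exact mem_signedLink_insert_or hWd h1
          ⟨(Finset.subset_insert_iff_of_notMem hes).1 hs.1, hs.2⟩
      · rw [signedLink_inter]
        by_cases h2 : ∅ ∈ M.signedLink (insert e P) (insert e N) W
        · refine ih _ _ ?_ ⟨a, by grind, by grind⟩ h2 m ?_
          · grind [Finset.disjoint_left]
          · rw [hins, Finset.card_insert_of_notMem (by grind)]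
            omega
        · rw [Set.eq_empty_of_forall_notMem fun s hs =>
            h2 (signedLink_down_closed s hs ∅ (Finset.empty_subset _))]
          exact cyclesBound_empty _
      · by_cases h2 : ∅ ∈ M.signedLink P (insert e N) W
        · refine ih _ _ ?_ ⟨a, by grind, by grind⟩ h2 _ ?_
          · grind [Finset.disjoint_left]
          · rwa [Finset.inter_insert_of_notMem heP]
        · rw [Set.eq_empty_of_forall_notMem fun s hs =>
            h2 (signedLink_down_closed s hs ∅ (Finset.empty_subset _))]
          exact cyclesBound_empty _
    · have hdrop : M.signedLink P N (insert e W) = M.signedLink P N W := by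
        ext s
        refine ⟨fun hs => ⟨?_, hs.2⟩,
          fun hs => ⟨hs.1.trans (Finset.subset_insert _ _), hs.2⟩⟩
        refine (Finset.subset_insert_iff_of_notMem fun hes => h1 ?_).1 hs.1
        refine ⟨Finset.empty_subset _, fun C hC hp => hs.2 C hC (hp.trans ?_)⟩
        grind
      rw [hdrop]
      exact ih P N hWd ⟨a, ha, ha'⟩ h0W n hn

lemma Indep.card_le_rank [Fintype V] {I : Finset V} (h : M.Indep I) : I.card ≤ M.rank :=
  le_csSup ⟨Fintype.card V, by rintro _ ⟨S, -, rfl⟩; exact S.card_le_univ⟩ ⟨I, h, rfl⟩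

lemma mem_suppComplex_faces {S : Finset V} :
    S ∈ M.suppComplex.faces ↔ ∀ C ∈ M.Circuits, C.pos ⊆ S → ¬ C.neg ⊆ ∅ := by
  simp only [Finset.subset_empty]
  exact ⟨fun h C hC hp hn => h _ hp ⟨C, hC, hn, rfl⟩,
    fun h T hT ⟨C, hC, hn, hp⟩ => h C hC (hp ▸ hT) hn⟩

lemma link_suppComplex_faces [Fintype V] {S : Finset V} (hS : S ∈ M.suppComplex.faces) :
    (M.suppComplex.link S hS).faces = M.signedLink S ∅ Sᶜ := by
  ext R
  change Disjoint R S ∧ R ∪ S ∈ M.suppComplex.faces ↔ _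
  rw [mem_suppComplex_faces, Finset.union_comm, ← Finset.subset_compl_iff_disjoint_right]
  rfl

end OrientedMatroid

end Chains

/-- For a loopless oriented matroid `M` of rank `r` on a finite ground set with
support complex `X`, and a non-empty face `S ∈ X`, the reduced homology
`H̃ⱼ(lk(S,X);ℚ)` vanishes for all `j ≥ r - 1` (in our indexing, `redH n = H̃_{n-1}`
vanishes for all `n ≥ r`). -/
theorem suppComplex_link_homology_vanish {V : Type*} [LinearOrder V] [Fintype V]
    (M : OrientedMatroid V) (hM : M.Loopless) (r : ℕ) (hr : M.rank = r)
    (S : Finset V) (hS : S ∈ M.suppComplex.faces) (hSne : S.Nonempty) :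
    ∀ n : ℕ, r ≤ n → Subsingleton ((M.suppComplex.link S hS).redH n) := by
  rw [← hr]
  intro n hn
  refine SimplicialCpx.subsingleton_redH ?_
  rw [OrientedMatroid.link_suppComplex_faces hS]
  obtain ⟨a, ha⟩ := hSne
  refine M.cyclesBound_signedLink (fun I hI => hI.card_le_rank) _ _ _ ?_
    ⟨a, by simpa using ha, by simp⟩ ⟨Finset.empty_subset _, ?_⟩ n (by simpa using hn)
  · simpa using disjoint_compl_left
  · simpa using OrientedMatroid.mem_suppComplex_faces.1 hS
end

section
/- Let F = {S_v}_{v∈V} be a finite family of open contractible subsets of ℝ^n such that every non-empty intersection ⋂_{v∈W} S_v (W ⊆ V) is contractible. Then the union ⋃_{v∈V} S_v is homotopy equivalent to the nerve complex N_F. -/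
namespace SimplicialCpx

/-- The geometric realization of a simplicial complex on a finite vertex set, as the
subspace of `V → ℝ` of convex-coefficient functions supported on a face. -/
def geomReal {V : Type*} [Fintype V] [DecidableEq V] (X : SimplicialCpx V) :
    Set (V → ℝ) :=
  {f | (∀ v, 0 ≤ f v) ∧ (∑ v, f v) = 1 ∧
    (Finset.univ.filter fun v => f v ≠ 0) ∈ X.faces}

end SimplicialCpx

/-- The nerve of a family of sets: faces are the subsets of the index set whose
corresponding sets have a common point. -/
def nerveCpx {V α : Type*} [Nonempty α] (S : V → Set α) : SimplicialCpx V where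
  faces := {t | (⋂ v ∈ (t : Set V), S v).Nonempty}
  down_closed := fun s hs t hts =>
    hs.mono (Set.biInter_subset_biInter_left (by exact_mod_cast hts))
  empty_mem := by simp

/-- `U` is an absolute extensor for the space `Y`: every continuous map into `U` from a closed
subset of `Y` extends to a continuous map from `Y` to `U`. -/
def IsExtensorFor (Y : Type*) [TopologicalSpace Y] {Z : Type*} [TopologicalSpace Z]
    (U : Set Z) : Prop :=
  ∀ A : Set Y, IsClosed A → ∀ f : Y → Z, ContinuousOn f A → Set.MapsTo f A U →
    ∃ g : Y → Z, Continuous g ∧ (∀ y, g y ∈ U) ∧ Set.EqOn g f A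

/-- A contractible neighbourhood retract in a space with the Tietze extension property is an
absolute extensor for normal spaces. -/
theorem isExtensorFor_of_contractible.{u, v} {Y : Type u} [TopologicalSpace Y] [NormalSpace Y]
    {E : Type v} [TopologicalSpace E] [TietzeExtension.{u, v} E] {U O : Set E} (hO : IsOpen O)
    (hUO : U ⊆ O) (r : E → E) (hr : ContinuousOn r O) (hrU : Set.MapsTo r O U)
    (hrid : Set.EqOn r id U) [ContractibleSpace U] : IsExtensorFor Y U := by
  classical
  intro A hA f hf hfU
  obtain ⟨F, hF⟩ := ContinuousMap.exists_restrict_eq hA ⟨A.domRestrict f, hf.domRestrict⟩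
  have hFA : ∀ y ∈ A, F y = f y := fun y hy => congrArg (fun h => h ⟨y, hy⟩) hF
  obtain ⟨W, hW, hAW, hWO⟩ := normal_exists_closure_subset hA (hO.preimage F.continuous)
    (fun y hy => by simpa [hFA y hy] using hUO (hfU hy))
  obtain ⟨l, hlA, hlW, hl⟩ := exists_continuous_zero_one_of_isClosed hA hW.isClosed_compl
    (Set.disjoint_compl_right_iff_subset.2 hAW)
  obtain ⟨u, ⟨H⟩⟩ := id_nullhomotopic U
  let p : closure W → U := fun y => ⟨r (F y), hrU (hWO y.2)⟩
  have hp : Continuous p := by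
    refine Continuous.subtype_mk ?_ _
    exact hr.comp_continuous (F.continuous.comp continuous_subtype_val) fun y => hWO y.2
  let g : Y → E := fun y =>
    if hy : y ∈ closure W then H (⟨l y, hl y⟩, p ⟨y, hy⟩) else u
  have hgW : ∀ y ∈ Wᶜ, g y = u := by
    intro y hy
    by_cases h : y ∈ closure W
    · have : (⟨l y, hl y⟩ : unitInterval) = 1 := Subtype.ext (hlW hy)
      simp [g, h, this]
    · simp [g, h]
  refine ⟨g, ?_, fun y => ?_, fun y hy => ?_⟩
  · rw [← continuousOn_univ]
    have hcov : closure W ∪ Wᶜ = Set.univ :=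
      Set.eq_univ_of_forall fun y => (em (y ∈ W)).imp (fun h => subset_closure h) id
    rw [← hcov]
    refine ContinuousOn.union_of_isClosed ?_ ?_ isClosed_closure hW.isClosed_compl
    · rw [continuousOn_iff_continuous_domRestrict]
      have : (closure W).domRestrict g =
          fun y : closure W => (H (⟨l y, hl y⟩, p y) : E) := by
        funext y
        simp [g]
      rw [this]
      fun_prop
    · exact continuousOn_const.congr hgW
  · by_cases h : y ∈ closure W <;> simp [g, h]
  · have h0 : (⟨l y, hl y⟩ : unitInterval) = 0 := Subtype.ext (hlA hy)
    have hU : f y ∈ U := hfU hy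
    simp [g, subset_closure (hAW hy), h0, p, hFA y hy, hrid hU]

section Carrier

variable {V Y Z : Type*} [Finite V] [TopologicalSpace Y] [TopologicalSpace Z]
  {M : V → Set Y} {T : Finset V → Set Z}

/-- Extension of carried maps: given a finite closed cover `M` of `Y` and an antitone family `T` of
absolute extensors, a map on a closed set that sends `⋂ v ∈ σ, M v` into `T σ` for every `σ`
extends to the whole space with the same property. -/
theorem exists_continuous_extension_carried (hM : ∀ v, IsClosed (M v))
    (hcov : ∀ y, ∃ v, y ∈ M v) (hT : Antitone T)
    (hext : ∀ σ : Finset V, σ.Nonempty → (∃ y, ∀ v ∈ σ, y ∈ M v) → IsExtensorFor Y (T σ))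
    (B : Set Y) (hB : IsClosed B) (f : Y → Z) (hf : ContinuousOn f B)
    (hfT : ∀ σ : Finset V, σ.Nonempty → ∀ y ∈ B, (∀ v ∈ σ, y ∈ M v) → f y ∈ T σ) :
    ∃ g : Y → Z, Continuous g ∧ Set.EqOn g f B ∧
      ∀ σ : Finset V, σ.Nonempty → ∀ y, (∀ v ∈ σ, y ∈ M v) → g y ∈ T σ := by
  classical
  cases nonempty_fintype V
  induction h : {σ : Finset V | σ.Nonempty ∧ ¬ {y | ∀ v ∈ σ, y ∈ M v} ⊆ B}.ncard
    using Nat.strong_induction_on generalizing B f with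
  | _ k ih =>
  set P : Set (Finset V) := {σ | σ.Nonempty ∧ ¬ {y | ∀ v ∈ σ, y ∈ M v} ⊆ B} with hP
  rcases P.eq_empty_or_nonempty with hPe | hPn
  · have hBu : ∀ y, y ∈ B := by
      intro y
      obtain ⟨v, hv⟩ := hcov y
      by_contra hy
      have : ({v} : Finset V) ∈ P := ⟨by simp, fun hs => hy (hs (by simpa using hv))⟩
      simp [hPe] at this
    have hBu' : B = Set.univ := Set.eq_univ_of_forall hBu
    exact ⟨f, continuousOn_univ.1 (hBu' ▸ hf), fun _ _ => rfl, fun σ hσ y => hfT σ hσ y (hBu y)⟩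
  · obtain ⟨σ, hσP, hmax⟩ := P.toFinite.exists_maximal hPn
    obtain ⟨hσ, hσB⟩ := hσP
    have hMσ : IsClosed {y | ∀ v ∈ σ, y ∈ M v} := by
      simp only [Set.ofPred_forall]
      exact isClosed_biInter fun v _ => hM v
    obtain ⟨y₀, hy₀, -⟩ := Set.not_subset.1 hσB
    obtain ⟨e, he, heT, hef⟩ := hext σ hσ ⟨y₀, hy₀⟩ (B ∩ {y | ∀ v ∈ σ, y ∈ M v})
      (hB.inter hMσ) f (hf.mono Set.inter_subset_left) fun y hy => hfT σ hσ y hy.1 hy.2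
    let f' : Y → Z := B.piecewise f e
    have hf'B : Set.EqOn f' f B := Set.piecewise_eqOn _ _ _
    have hf'e : Set.EqOn f' e {y | ∀ v ∈ σ, y ∈ M v} := by
      intro y hy
      by_cases hyB : y ∈ B
      · rw [hf'B hyB, hef ⟨hyB, hy⟩]
      · exact Set.piecewise_eq_of_notMem _ _ _ hyB
    obtain ⟨g, hg, hgf, hgT⟩ := ih
      {τ : Finset V | τ.Nonempty ∧ ¬ {y | ∀ v ∈ τ, y ∈ M v} ⊆ B ∪ {y | ∀ v ∈ σ, y ∈ M v}}.ncard
      (by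
        rw [← h]
        refine Set.ncard_lt_ncard ⟨fun τ hτ => ⟨hτ.1, fun hs => hτ.2 fun y hy => .inl (hs hy)⟩,
          fun hs => ?_⟩ (Set.toFinite _)
        exact (hs ⟨hσ, hσB⟩).2 Set.subset_union_right)
      (B ∪ {y | ∀ v ∈ σ, y ∈ M v}) (hB.union hMσ) f'
      ((hf.congr hf'B).union_of_isClosed (he.continuousOn.congr hf'e) hB hMσ)
      (by
        intro τ hτ y hy hyτ
        by_cases hyB : y ∈ B
        · rw [hf'B hyB]
          exact hfT τ hτ y hyB hyτ
        have hyσ : ∀ v ∈ σ, y ∈ M v := hy.resolve_left hyB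
        have hsub : τ ⊆ σ := by
          have hmem : σ ∪ τ ∈ P := by
            refine ⟨hσ.mono Finset.subset_union_left, fun hs => hyB (hs fun v hv => ?_)⟩
            exact (Finset.mem_union.1 hv).elim (hyσ v) (hyτ v)
          exact Finset.subset_union_right.trans (hmax hmem Finset.subset_union_left)
        rw [hf'e hyσ]
        exact hT hsub (heT y))
      rfl
    exact ⟨g, hg, fun y hy => (hgf (.inl hy)).trans (hf'B hy), hgT⟩

/-- Two maps carried by the same family of absolute extensors are homotopic. -/
theorem ContinuousMap.homotopic_of_carried {s : Set Z} (hM : ∀ v, IsClosed (M v))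
    (hcov : ∀ y, ∃ v, y ∈ M v) (hT : Antitone T) (hTs : ∀ σ : Finset V, σ.Nonempty → T σ ⊆ s)
    (hext : ∀ σ : Finset V, σ.Nonempty → (∃ y, ∀ v ∈ σ, y ∈ M v) →
      IsExtensorFor (unitInterval × Y) (T σ))
    (f₀ f₁ : C(Y, s))
    (h₀ : ∀ σ : Finset V, σ.Nonempty → ∀ y, (∀ v ∈ σ, y ∈ M v) → (f₀ y : Z) ∈ T σ)
    (h₁ : ∀ σ : Finset V, σ.Nonempty → ∀ y, (∀ v ∈ σ, y ∈ M v) → (f₁ y : Z) ∈ T σ) :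
    f₀.Homotopic f₁ := by
  classical
  let B₀ : Set (unitInterval × Y) := {p | p.1 = 0}
  let B₁ : Set (unitInterval × Y) := {p | p.1 = 1}
  have hB₀ : IsClosed B₀ := isClosed_eq continuous_fst continuous_const
  have hB₁ : IsClosed B₁ := isClosed_eq continuous_fst continuous_const
  let f : unitInterval × Y → Z := fun p => if p.1 = 0 then f₀ p.2 else f₁ p.2
  have hf₀ : ∀ p ∈ B₀, f p = f₀ p.2 := fun p hp => if_pos hp
  have hf₁ : ∀ p ∈ B₁, f p = f₁ p.2 := fun p hp => if_neg (by
    rw [show p.1 = 1 from hp]; exact one_ne_zero)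
  obtain ⟨g, hg, hgf, hgT⟩ := exists_continuous_extension_carried
    (M := fun v => Prod.snd ⁻¹' M v) (T := T) (fun v => (hM v).preimage continuous_snd)
    (fun p => hcov p.2) hT (fun σ hσ ⟨p, hp⟩ => hext σ hσ ⟨p.2, hp⟩) (B₀ ∪ B₁) (hB₀.union hB₁) f
    (by
      refine ContinuousOn.union_of_isClosed ?_ ?_ hB₀ hB₁
      · exact ContinuousOn.congr (by fun_prop) hf₀
      · exact ContinuousOn.congr (by fun_prop) hf₁)
    (by
      rintro σ hσ p (hp | hp) hpM
      · rw [hf₀ p hp]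
        exact h₀ σ hσ _ hpM
      · rw [hf₁ p hp]
        exact h₁ σ hσ _ hpM)
  have hgs : ∀ p, g p ∈ s := by
    intro p
    obtain ⟨v, hv⟩ := hcov p.2
    exact hTs {v} (by simp) (hgT {v} (by simp) p (by simpa using hv))
  refine ⟨⟨⟨fun p => ⟨g p, hgs p⟩, by fun_prop⟩, fun y => ?_, fun y => ?_⟩⟩
  · exact Subtype.ext ((hgf (.inl rfl)).trans (hf₀ (0, y) rfl))
  · exact Subtype.ext ((hgf (.inr rfl)).trans (hf₁ (1, y) rfl))

end Carrier

namespace SimplicialCpx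

variable {V : Type*} [Fintype V] [DecidableEq V]

/-- The closed star of a face. -/
def closedStar (X : SimplicialCpx V) (σ : Finset V) (hσ : σ ∈ X.faces) : SimplicialCpx V where
  faces := {s | s ∪ σ ∈ X.faces}
  down_closed := fun _ hs _ hts =>
    X.down_closed _ hs _ (Finset.union_subset_union_left hts)
  empty_mem := by simpa using hσ

theorem starConvex_geomReal (X : SimplicialCpx V) (v : V)
    (hv : ∀ s ∈ X.faces, insert v s ∈ X.faces) :
    StarConvex ℝ (Pi.single v 1) X.geomReal := by
  rintro x ⟨hx0, hx1, hxX⟩ a b ha hb hab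
  refine ⟨fun w => ?_, ?_, X.down_closed _ (hv _ hxX) _ fun w hw => ?_⟩
  · have : (0 : ℝ) ≤ (Pi.single v 1 : V → ℝ) w := by
      by_cases h : w = v
      · simp [h]
      · simp [h]
    have := hx0 w
    simp only [Pi.add_apply, Pi.smul_apply, smul_eq_mul]
    positivity
  · simp [Finset.sum_add_distrib, ← Finset.mul_sum, hx1, hab]
  · simp only [Finset.mem_insert, Finset.mem_filter, Finset.mem_univ, true_and] at hw ⊢
    by_contra! h
    simp [h.1, h.2] at hw

theorem contractibleSpace_geomReal (X : SimplicialCpx V) (v : V)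
    (hv : ∀ s ∈ X.faces, insert v s ∈ X.faces) : ContractibleSpace X.geomReal := by
  refine (X.starConvex_geomReal v hv).contractibleSpace ⟨Pi.single v 1, fun w => ?_, by simp, ?_⟩
  · by_cases h : w = v
    · simp [h]
    · simp [h]
  · refine X.down_closed _ (hv _ X.empty_mem) _ fun w hw => ?_
    by_contra h
    simp_all

/-- The geometric realization of a finite simplicial complex is a neighbourhood retract. -/
theorem exists_neighborhood_retraction_geomReal (X : SimplicialCpx V) :
    ∃ (O : Set (V → ℝ)) (r : (V → ℝ) → V → ℝ), IsOpen O ∧ X.geomReal ⊆ O ∧ ContinuousOn r O ∧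
      Set.MapsTo r O X.geomReal ∧ Set.EqOn r id X.geomReal := by
  classical
  have hne : ∀ τ : {τ : Finset V // τ ∉ X.faces}, τ.1.Nonempty := fun τ =>
    Finset.nonempty_iff_ne_empty.2 fun h => τ.2 (h ▸ X.empty_mem)
  let m (τ : {τ : Finset V // τ ∉ X.faces}) (x : V → ℝ) : ℝ :=
    max (τ.1.inf' (hne τ) fun v => x v) 0
  have hm : ∀ τ, Continuous (m τ) := fun τ =>
    (Continuous.finset_inf'_apply (hne τ) fun v _ => continuous_apply v).max continuous_const
  let t (x : V → ℝ) : ℝ := ∑ τ, m τ x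
  have ht : Continuous t := continuous_finsetSum _ fun τ _ => hm τ
  let y (x : V → ℝ) (v : V) : ℝ := max (x v - t x) 0
  have hy : ∀ v, Continuous fun x => y x v := fun v => by fun_prop
  have hy0 : ∀ x v, 0 ≤ y x v := fun x v => le_max_right _ _
  let s (x : V → ℝ) : ℝ := ∑ v, y x v
  have hs : Continuous s := continuous_finsetSum _ fun v _ => hy v
  have hyX : ∀ x ∈ X.geomReal, y x = x := by
    rintro x ⟨hx0, -, hxX⟩
    have ht0 : t x = 0 := by
      refine Finset.sum_eq_zero fun τ _ => max_eq_right ?_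
      have : ¬ τ.1 ⊆ Finset.univ.filter fun v => x v ≠ 0 := fun h =>
        τ.2 (X.down_closed _ hxX _ h)
      obtain ⟨v, hv, hvx⟩ := Finset.not_subset.1 this
      have hvx' : x v = 0 := by simpa using hvx
      exact hvx' ▸ Finset.inf'_le (fun v => x v) hv
    funext v
    simp [y, ht0, hx0 v]
  refine ⟨{x | 0 < s x}, fun x v => y x v / s x, isOpen_lt continuous_const hs, ?_, ?_, ?_, ?_⟩
  · intro x hx
    simp [s, hyX x hx, hx.2.1]
  · refine continuousOn_pi.2 fun v => ?_
    exact (hy v).continuousOn.div hs.continuousOn fun x hx => (show 0 < s x from hx).ne'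
  · intro x hx
    have hx : 0 < s x := hx
    refine ⟨fun v => div_nonneg (hy0 x v) hx.le, ?_, ?_⟩
    · rw [← Finset.sum_div]
      exact div_self hx.ne'
    · by_contra hτ
      set τ : {τ : Finset V // τ ∉ X.faces} := ⟨_, hτ⟩
      have h1 : τ.1.inf' (hne τ) (fun v => x v) ≤ t x :=
        (le_max_left _ _).trans
          (Finset.single_le_sum (f := fun τ => m τ x) (fun τ _ => le_max_right _ _)
            (Finset.mem_univ τ))
      refine h1.not_gt ((Finset.lt_inf'_iff _).2 fun v hv => ?_)
      have hv' : y x v / s x ≠ 0 := (Finset.mem_filter.1 hv).2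
      by_contra! hle
      exact hv' (by simp [y, hle])
  · intro x hx
    funext v
    simp [s, hyX x hx, hx.2.1]

theorem isExtensorFor_geomReal_of_contractible {Y : Type*} [TopologicalSpace Y] [NormalSpace Y]
    (X : SimplicialCpx V) [ContractibleSpace X.geomReal] : IsExtensorFor Y X.geomReal := by
  obtain ⟨O, r, hO, hXO, hr, hrX, hrid⟩ := X.exists_neighborhood_retraction_geomReal
  exact isExtensorFor_of_contractible hO hXO r hr hrX hrid

theorem isExtensorFor_geomReal_closedStar {Y : Type*} [TopologicalSpace Y] [NormalSpace Y]
    (X : SimplicialCpx V) (σ : Finset V) (hσ : σ ∈ X.faces) (hne : σ.Nonempty) :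
    IsExtensorFor Y (X.closedStar σ hσ).geomReal := by
  obtain ⟨v, hv⟩ := hne
  have : ContractibleSpace (X.closedStar σ hσ).geomReal :=
    contractibleSpace_geomReal _ v fun s hs => by
      have : insert v s ∪ σ = s ∪ σ := by
        ext w
        simp only [Finset.mem_union, Finset.mem_insert]
        grind
      simpa [closedStar, this] using hs
  exact isExtensorFor_geomReal_of_contractible _

/-- Every point of a geometric realization has a barycentric coordinate at least `1 / |V|`. -/
theorem exists_inv_card_le_of_mem_geomReal (X : SimplicialCpx V) {x : V → ℝ}
    (hx : x ∈ X.geomReal) : ∃ v, (Fintype.card V : ℝ)⁻¹ ≤ x v := by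
  by_contra! h
  have hne : (Finset.univ : Finset V).Nonempty := by
    by_contra hV
    have := hx.2.1
    simp [Finset.not_nonempty_iff_eq_empty.1 hV] at this
  have hlt := Finset.sum_lt_sum_of_nonempty hne fun v _ => h v
  have hcard : (Fintype.card V : ℝ) ≠ 0 := by
    have := Finset.card_pos.2 hne
    rw [Finset.card_univ] at this
    positivity
  simp [hx.2.1, hcard] at hlt

end SimplicialCpx

/-- An open cover of a paracompact normal space admits a map to the nerve of the cover, given by a
subordinate partition of unity. -/
theorem exists_continuous_geomReal_nerveCpx {V α : Type*} [Fintype V] [DecidableEq V]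
    [Nonempty α] [TopologicalSpace α] (S : V → Set α) (hopen : ∀ v, IsOpen (S v))
    [NormalSpace ↥(⋃ v, S v)] [ParacompactSpace ↥(⋃ v, S v)] :
    ∃ f : C(↥(⋃ v, S v), ↥(nerveCpx S).geomReal), ∀ y v, (f y : V → ℝ) v ≠ 0 → (y : α) ∈ S v := by
  obtain ⟨ρ, hρ⟩ := PartitionOfUnity.exists_isSubordinate (X := ↥(⋃ v, S v)) isClosed_univ
    (fun v => Subtype.val ⁻¹' S v) (fun v => (hopen v).preimage continuous_subtype_val)
    (fun y _ => by simpa using Set.mem_iUnion.1 y.2)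
  have hsupp : ∀ (y : ↥(⋃ v, S v)) v, ρ v y ≠ 0 → (y : α) ∈ S v := fun y v h =>
    hρ v (subset_tsupport _ h)
  refine ⟨⟨fun y => ⟨fun v => ρ v y, fun v => ρ.nonneg v y, ?_, ?_⟩, by fun_prop⟩, hsupp⟩
  · rw [← finsum_eq_sum_of_fintype]
    exact ρ.sum_eq_one (Set.mem_univ y)
  · refine ⟨y, Set.mem_iInter₂.2 fun v hv => hsupp y v ?_⟩
    simpa using hv

theorem isExtensorFor_of_isOpen_of_contractible.{u, v} {Y : Type u} [TopologicalSpace Y]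
    [NormalSpace Y] {E : Type v} [TopologicalSpace E] [TietzeExtension.{u, v} E] {U : Set E}
    (hU : IsOpen U) [ContractibleSpace U] : IsExtensorFor Y U :=
  isExtensorFor_of_contractible hU subset_rfl id continuousOn_id (Set.mapsTo_id _)
    fun _ _ => rfl

/-- **Nerve theorem.** Let `{S_v}_{v ∈ V}` be a finite family of open contractible
subsets of `ℝⁿ` such that every non-empty intersection `⋂_{v ∈ W} S_v` is
contractible.  Then the union `⋃_v S_v` is homotopy equivalent to (the geometric
realization of) the nerve complex. -/
theorem nerve_theorem {V : Type*} [Fintype V] [DecidableEq V] (n : ℕ)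
    (S : V → Set (EuclideanSpace ℝ (Fin n)))
    (hopen : ∀ v, IsOpen (S v))
    (hcontr : ∀ v, ContractibleSpace (S v))
    (hgood : ∀ W : Finset V, (⋂ v ∈ W, S v).Nonempty →
      ContractibleSpace ↥(⋂ v ∈ W, S v)) :
    Nonempty (ContinuousMap.HomotopyEquiv ↥(⋃ v, S v) ↥((nerveCpx S).geomReal)) := by
  obtain ⟨f, hf⟩ := exists_continuous_geomReal_nerveCpx S hopen
  let c : ℝ := (Fintype.card V : ℝ)⁻¹
  let M : V → Set ↥(nerveCpx S).geomReal := fun v => {x | c ≤ (x : V → ℝ) v}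
  have hM : ∀ v, IsClosed (M v) := fun v =>
    isClosed_le continuous_const ((continuous_apply v).comp continuous_subtype_val)
  have hcov : ∀ x, ∃ v, x ∈ M v := fun x =>
    (nerveCpx S).exists_inv_card_le_of_mem_geomReal x.2
  have hMne : ∀ v, ∀ x ∈ M v, (x : V → ℝ) v ≠ 0 := by
    intro v x hx
    have : Nonempty V := ⟨v⟩
    have hc : 0 < c := inv_pos.2 (by exact_mod_cast Fintype.card_pos)
    exact (hc.trans_le hx).ne'
  have hMface : ∀ (σ : Finset V) x, (∀ v ∈ σ, x ∈ M v) → σ ∈ (nerveCpx S).faces :=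
    fun σ x hx => (nerveCpx S).down_closed _ x.2.2.2 _ fun v hv => by
      simpa using hMne v x (hx v hv)
  have hSanti : Antitone fun σ : Finset V => ⋂ v ∈ σ, S v := fun σ τ h =>
    Set.biInter_subset_biInter_left h
  obtain ⟨g₀, hg₀, -, hg₀S⟩ := exists_continuous_extension_carried hM hcov hSanti
    (fun σ _ ⟨x, hx⟩ => by
      have := hgood σ (hMface σ x hx)
      exact isExtensorFor_of_isOpen_of_contractible
        (isOpen_biInter_finset fun v _ => hopen v))
    ∅ isClosed_empty (fun _ => 0) (continuousOn_empty _) (by simp)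
  have hg₀v : ∀ v, ∀ x ∈ M v, g₀ x ∈ S v := fun v x hx => by
    simpa using hg₀S {v} (by simp) x (by simpa using hx)
  let g : C(↥(nerveCpx S).geomReal, ↥(⋃ v, S v)) :=
    ⟨fun x => ⟨g₀ x, by
      obtain ⟨v, hv⟩ := hcov x
      exact Set.mem_iUnion.2 ⟨v, hg₀v v x hv⟩⟩, by fun_prop⟩
  refine ⟨⟨f, g, ?_, ?_⟩⟩
  · refine ContinuousMap.homotopic_of_carried (M := fun v => f ⁻¹' M v)
      (fun v => (hM v).preimage f.continuous) (fun y => hcov (f y)) hSanti ?_ ?_ _ _ ?_ ?_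
    · rintro σ ⟨v, hv⟩
      exact (Set.biInter_subset_of_mem hv).trans (Set.subset_iUnion S v)
    · rintro σ - ⟨y, hy⟩
      have := hgood σ (hMface σ (f y) hy)
      exact isExtensorFor_of_isOpen_of_contractible (isOpen_biInter_finset fun v _ => hopen v)
    · exact fun σ hσ y hy => hg₀S σ hσ (f y) hy
    · exact fun σ _ y hy => Set.mem_iInter₂.2 fun v hv => hf y v (hMne v _ (hy v hv))
  · let T : Finset V → Set (V → ℝ) := fun σ =>
      {x ∈ (nerveCpx S).geomReal |
        (Finset.univ.filter fun v => x v ≠ 0) ∪ σ ∈ (nerveCpx S).faces}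
    refine ContinuousMap.homotopic_of_carried (M := M) (T := T) hM hcov ?_ ?_ ?_ _ _ ?_ ?_
    · exact fun σ τ h x hx => ⟨hx.1, (nerveCpx S).down_closed _ hx.2 _
        (Finset.union_subset_union_right h)⟩
    · exact fun σ _ x hx => hx.1
    · rintro σ hσ ⟨x, hx⟩
      have hσX := hMface σ x hx
      have hTσ : T σ = ((nerveCpx S).closedStar σ hσX).geomReal := by
        ext z
        exact ⟨fun hz => ⟨hz.1.1, hz.1.2.1, hz.2⟩, fun hz => ⟨⟨hz.1, hz.2.1,
          (nerveCpx S).down_closed _ hz.2.2 _ Finset.subset_union_left⟩, hz.2.2⟩⟩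
      rw [hTσ]
      exact (nerveCpx S).isExtensorFor_geomReal_closedStar σ hσX hσ
    · refine fun σ hσ x hx => ⟨(f (g x)).2, g₀ x, Set.mem_iInter₂.2 fun v hv => ?_⟩
      rcases Finset.mem_union.1 hv with hv | hv
      · exact hf (g x) v (by simpa using hv)
      · exact hg₀v v x (hx v hv)
    · refine fun σ hσ x hx => ⟨x.2, (nerveCpx S).down_closed _ x.2.2.2 _ ?_⟩
      refine Finset.union_subset subset_rfl fun v hv => ?_
      simpa using hMne v x (hx v hv)
end
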